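/- arXiv:1504.05624 — 3 statements merged into one kernel-verified Lean document; each statement's English description precedes it below -/
import Mathlib

section
/- (Discretized form, d = 3) For every ε > 0 there exist C_ε > 0 and δ₀ > 0 such that the following holds in the discretized setup with d = 3 and δ ∈ (0,δ₀): M δ² ≤ C_ε (λ^{-5/2} δ^{-1/2-ε} |E|)^{4/3}. -/
open MeasureTheory Metric Set
open scoped ENNReal RealInnerProductSpace

noncomputable section

/-- The `δ`-tube centered at `a` in direction `ξ`:
`T^δ_ξ(a) = {x : |(x−a)·ξ| ≤ 1/2, |(x−a) − ((x−a)·ξ)ξ| ≤ δ}`. -/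
def tube (d : ℕ) (δ : ℝ) (ξ a : EuclideanSpace ℝ (Fin d)) : Set (EuclideanSpace ℝ (Fin d)) :=
  {x | abs ⟪x - a, ξ⟫ ≤ 1 / 2 ∧ ‖(x - a) - ⟪x - a, ξ⟫ • ξ‖ ≤ δ}

/-- The Kakeya maximal function `f*_δ(ξ) = sup_a |T^δ_ξ(a)|⁻¹ ∫_{T^δ_ξ(a)} |f|`. -/
def kakeyaMax (d : ℕ) (δ : ℝ) (f : EuclideanSpace ℝ (Fin d) → ℝ)
    (ξ : EuclideanSpace ℝ (Fin d)) : ℝ≥0∞ :=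
  ⨆ a : EuclideanSpace ℝ (Fin d),
    (∫⁻ x in tube d δ ξ a, ENNReal.ofReal |f x|) / volume (tube d δ ξ a)

/-- The surface measure on the unit sphere `S^{d-1} ⊆ ℝ^d`, realized as the
`(d-1)`-dimensional Hausdorff measure restricted to the sphere. -/
def sphereMeasure (d : ℕ) : Measure (EuclideanSpace ℝ (Fin d)) :=
  (μH[(d : ℝ) - 1]).restrict (sphere (0 : EuclideanSpace ℝ (Fin d)) 1)

/-- The central axis `γ = {a + tξ : |t| ≤ 1/2}` of the tube `T^δ_ξ(a)`. -/
def axisSeg (d : ℕ) (ξ a : EuclideanSpace ℝ (Fin d)) : Set (EuclideanSpace ℝ (Fin d)) :=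
  {y | ∃ t : ℝ, |t| ≤ 1 / 2 ∧ y = a + t • ξ}

/-- The discretized setup: `δ ∈ (0,1)`, `λ ∈ [δ,1]`, `E ⊆ B(0,1)` measurable,
`ξ¹,…,ξ^M ∈ S^{d-1}` δ-separated directions, and tubes `T^δ_j = T^δ_{ξ^j}(a_j)` with
`|E ∩ T^δ_j| ≥ (λ/2)|T^δ_j|`. -/
def DiscretizedSetup (d M : ℕ) (δ lam : ℝ) (E : Set (EuclideanSpace ℝ (Fin d)))
    (ξ a : Fin M → EuclideanSpace ℝ (Fin d)) : Prop :=
  0 < δ ∧ δ < 1 ∧ lam ∈ Set.Icc δ 1 ∧ MeasurableSet E ∧ E ⊆ ball 0 1 ∧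
    (∀ i, ‖ξ i‖ = 1) ∧ (∀ i j, i ≠ j → δ ≤ dist (ξ i) (ξ j)) ∧
    ∀ j, ENNReal.ofReal (lam / 2) * volume (tube d δ (ξ j) (a j)) ≤
      volume (E ∩ tube d δ (ξ j) (a j))

/-- The index set `I_{θ,σ}(x,j)` of tubes through `x` making angle `≈ θ` with `T^δ_j` and
meeting `E` in the `σ`-annulus around the axis `γ_j` in large measure. -/
def Itubes (d M : ℕ) (δ lam θ σ : ℝ) (E : Set (EuclideanSpace ℝ (Fin d)))
    (ξ a : Fin M → EuclideanSpace ℝ (Fin d)) (x : EuclideanSpace ℝ (Fin d)) (j : Fin M) :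
    Set (Fin M) :=
  {i | x ∈ tube d δ (ξ i) (a i) ∧
    InnerProductGeometry.angle (ξ i) (ξ j) ∈ Set.Ico (θ / 2) θ ∧
    ENNReal.ofReal ((2 ^ 4 * Real.logb 2 (1 / δ))⁻¹ * lam) * volume (tube d δ (ξ i) (a i)) ≤
      volume (tube d δ (ξ i) (a i) ∩
        {y ∈ E | Metric.infDist y (axisSeg d (ξ j) (a j)) ∈ Set.Ico (σ / 2) σ})}

/-- Scenario I (low multiplicity): at least `M/2` indices `j` satisfy
`|T^δ_j ∩ E ∩ {x : Σ_{l≠j} χ_{T^δ_l}(x) ≤ N₁}| ≥ (λ/4)|T^δ_j|`. -/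
def ScenarioI (d M : ℕ) (δ lam : ℝ) (E : Set (EuclideanSpace ℝ (Fin d)))
    (ξ a : Fin M → EuclideanSpace ℝ (Fin d)) (N₁ : ℕ) : Prop :=
  (M : ℝ) / 2 ≤
    ({j : Fin M | ENNReal.ofReal (lam / 4) * volume (tube d δ (ξ j) (a j)) ≤
      volume (tube d δ (ξ j) (a j) ∩ E ∩
        {x | ({l : Fin M | l ≠ j ∧ x ∈ tube d δ (ξ l) (a l)}.ncard ≤ N₁)})}.ncard : ℝ)

/-- The index `j` is counted in scenario II_{θσ} (with multiplicity parameter `N₂`):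
`|T^δ_j ∩ E ∩ {x : #I_{θ,σ}(x,j) ≥ 2^{-3}(log₂(1/δ))^{-2} N₂}|
  ≥ 2^{-3}(2log₂(1/δ))^{-2} λ |T^δ_j|`. -/
def CountedII (d M : ℕ) (δ lam θ σ : ℝ) (E : Set (EuclideanSpace ℝ (Fin d)))
    (ξ a : Fin M → EuclideanSpace ℝ (Fin d)) (N₂ : ℕ) (j : Fin M) : Prop :=
  ENNReal.ofReal ((2 ^ 3)⁻¹ * (2 * Real.logb 2 (1 / δ))⁻¹ ^ 2 * lam) *
      volume (tube d δ (ξ j) (a j)) ≤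
    volume (tube d δ (ξ j) (a j) ∩ E ∩
      {x | (2 ^ 3 : ℝ)⁻¹ * (Real.logb 2 (1 / δ))⁻¹ ^ 2 * N₂ ≤
        ((Itubes d M δ lam θ σ E ξ a x j).ncard : ℝ)})

/-- Scenario II_{θσ} (high multiplicity at angle `θ` and distance `σ`): at least
`M/(2⁴(log₂(1/δ))²)` indices `j` are counted. -/
def ScenarioII (d M : ℕ) (δ lam θ σ : ℝ) (E : Set (EuclideanSpace ℝ (Fin d)))
    (ξ a : Fin M → EuclideanSpace ℝ (Fin d)) (N₂ : ℕ) : Prop :=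
  (M : ℝ) / (2 ^ 4 * Real.logb 2 (1 / δ) ^ 2) ≤
    ({j : Fin M | CountedII d M δ lam θ σ E ξ a N₂ j}.ncard : ℝ)

abbrev WW := Fin 2 → ℝ
abbrev XX := ℝ × WW

/-- sheared box -/
def sbox (c η : ℝ) (p v : WW) (r : ℝ) : Set XX :=
  {z | |z.1 - c| ≤ η ∧ ‖z.2 - p - z.1 • v‖ ≤ r}

lemma sbox_closed (c η : ℝ) (p v : WW) (r : ℝ) : IsClosed (sbox c η p v r) := by
  have h1 : IsClosed {z : XX | |z.1 - c| ≤ η} := isClosed_le (by fun_prop) (by fun_prop)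
  have h2 : IsClosed {z : XX | ‖z.2 - p - z.1 • v‖ ≤ r} := isClosed_le (by fun_prop) (by fun_prop)
  exact h1.inter h2

lemma sbox_meas (c η : ℝ) (p v : WW) (r : ℝ) : MeasurableSet (sbox c η p v r) :=
  (sbox_closed c η p v r).measurableSet

lemma sbox_volume (c η : ℝ) (p v : WW) (r : ℝ) (hr : 0 ≤ r) :
    volume (sbox c η p v r) = ENNReal.ofReal (2 * η) * ENNReal.ofReal ((2 * r) ^ 2) := by
  rw [Measure.volume_eq_prod, Measure.prod_apply (sbox_meas c η p v r)]
  have h : ∀ t : ℝ, volume (Prod.mk t ⁻¹' sbox c η p v r) =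
      (Icc (c - η) (c + η)).indicator (fun _ => ENNReal.ofReal ((2 * r) ^ 2)) t := by
    intro t
    by_cases ht : t ∈ Icc (c - η) (c + η)
    · rw [indicator_of_mem ht]
      have : Prod.mk t ⁻¹' sbox c η p v r = closedBall (p + t • v) r := by
        ext y
        simp only [sbox, mem_preimage, mem_ofPred_eq, mem_closedBall, dist_eq_norm]
        have h1 : |t - c| ≤ η := by rw [abs_le]; constructor <;> linarith [ht.1, ht.2]
        rw [show y - p - t • v = y - (p + t • v) by abel]
        simp [h1]
      rw [this, Real.volume_pi_closedBall _ hr]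
      simp
    · rw [indicator_of_notMem ht]
      have : Prod.mk t ⁻¹' sbox c η p v r = ∅ := by
        ext y
        simp only [sbox, mem_preimage, mem_ofPred_eq, mem_empty_iff_false, iff_false, not_and]
        intro h1
        exfalso; apply ht
        rw [abs_le] at h1
        constructor <;> linarith [h1.1, h1.2]
      rw [this]; simp
  simp_rw [h]
  rw [lintegral_indicator measurableSet_Icc, setLIntegral_const, Real.volume_Icc, mul_comm]
  congr 2; ring

lemma sbox_volume_ne_top (c η : ℝ) (p v : WW) (r : ℝ) (hr : 0 ≤ r) :
    volume (sbox c η p v r) ≠ ∞ := by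
  rw [sbox_volume c η p v r hr]; finiteness

lemma sbox_real (c η : ℝ) (p v : WW) (r : ℝ) (hη : 0 ≤ η) (hr : 0 ≤ r) :
    volume.real (sbox c η p v r) = 2 * η * (2 * r) ^ 2 := by
  rw [measureReal_def, sbox_volume c η p v r hr, ENNReal.toReal_mul, ENNReal.toReal_ofReal,
    ENNReal.toReal_ofReal] <;> positivity

lemma WW_norm_eq (w : WW) : ‖w‖ = |w 0| ∨ ‖w‖ = |w 1| := by
  have h : ‖w‖ = max |w 0| |w 1| := by
    rw [Pi.norm_def]
    simp [Fin.univ_succ]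
  rw [h]; exact max_choice _ _

lemma WW_abs_le (w : WW) (i : Fin 2) : |w i| ≤ ‖w‖ := norm_le_pi_norm w i

lemma sbox_inter (c c' η η' : ℝ) (p v p' v' : WW) (r : ℝ) (hr : 0 ≤ r) (hv : 0 < ‖v - v'‖) :
    volume.real (sbox c η p v r ∩ sbox c' η' p' v' r) ≤ 16 * r ^ 3 / ‖v - v'‖ := by
  obtain ⟨i, hi⟩ : ∃ i, ‖v - v'‖ = |v i - v' i| := by
    rcases WW_norm_eq (v - v') with h | h
    · exact ⟨0, h⟩
    · exact ⟨1, h⟩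
  set ρ := ‖v - v'‖ with hρ
  have hne : v i - v' i ≠ 0 := by
    intro h; rw [h] at hi; simp at hi; linarith
  set t0 := -(p i - p' i) / (v i - v' i) with ht0
  have hsub : sbox c η p v r ∩ sbox c' η' p' v' r ⊆ sbox t0 (2 * r / ρ) p v r := by
    rintro z ⟨⟨_, h2⟩, ⟨_, h4⟩⟩
    refine ⟨?_, h2⟩
    have e1 := (WW_abs_le _ i).trans h2
    have e2 := (WW_abs_le _ i).trans h4
    simp only [Pi.sub_apply, Pi.smul_apply, smul_eq_mul] at e1 e2
    have e3 : |(p i - p' i) + z.1 * (v i - v' i)| ≤ 2 * r := by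
      rw [abs_le] at *; constructor <;> nlinarith [e1.1, e1.2, e2.1, e2.2]
    rw [le_div_iff₀ hv, hi, ← abs_mul]
    have : (z.1 - t0) * (v i - v' i) = (p i - p' i) + z.1 * (v i - v' i) := by
      rw [ht0]; field_simp; ring
    rw [this]; exact e3
  calc _ ≤ volume.real (sbox t0 (2 * r / ρ) p v r) :=
        measureReal_mono hsub (sbox_volume_ne_top _ _ _ _ _ hr)
    _ = _ := by
        rw [sbox_real _ _ _ _ _ (by positivity) hr]; ring

lemma packing {ι : Type*} (S : Finset ι) (x y : ι → ℝ) (s m a A b B : ℝ) (hs : 0 < s)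
    (hm : |m| ≤ 1) (hsep : ∀ i ∈ S, ∀ j ∈ S, i ≠ j → s ≤ max |x i - x j| |y i - y j|)
    (hx : ∀ i ∈ S, a ≤ x i ∧ x i ≤ a + A) (hy : ∀ i ∈ S, b ≤ y i - m * x i ∧ y i - m * x i ≤ b + B)
    (hA : 0 ≤ A) (hB : 0 ≤ B) :
    (S.card : ℝ) ≤ (2 * A / s + 1) * (2 * B / s + 1) := by
  classical
  let f : ι → ℕ × ℕ := fun i => (⌊(x i - a) / (s / 2)⌋₊, ⌊(y i - m * x i - b) / (s / 2)⌋₊)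
  have key : ∀ u u' : ℝ, 0 ≤ u → 0 ≤ u' → ⌊u / (s / 2)⌋₊ = ⌊u' / (s / 2)⌋₊ → |u - u'| < s / 2 := by
    intro u u' hu hu' h
    have h1 := Nat.floor_le (show 0 ≤ u / (s / 2) by positivity)
    have h2 := Nat.lt_floor_add_one (u / (s / 2))
    have h3 := Nat.floor_le (show 0 ≤ u' / (s / 2) by positivity)
    have h4 := Nat.lt_floor_add_one (u' / (s / 2))
    rw [h] at h1 h2
    have h5 : |u / (s / 2) - u' / (s / 2)| < 1 := by rw [abs_lt]; constructor <;> linarith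
    rw [← sub_div, abs_div, abs_of_pos (by positivity : 0 < s / 2), div_lt_one (by positivity)] at h5
    exact h5
  have hcard : S.card ≤ ((Finset.range (⌊2 * A / s⌋₊ + 1)) ×ˢ (Finset.range (⌊2 * B / s⌋₊ + 1))).card := by
    apply Finset.card_le_card_of_injOn f
    · intro i hi
      have hi' : i ∈ S := hi
      simp only [f, Finset.coe_product, Finset.coe_range, mem_prod, mem_Iio]
      constructor
      · apply Nat.lt_succ_of_le
        apply Nat.floor_le_floor
        rw [div_div_eq_mul_div]
        have := hx i hi'
        exact div_le_div_of_nonneg_right (by linarith) hs.le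
      · apply Nat.lt_succ_of_le
        apply Nat.floor_le_floor
        rw [div_div_eq_mul_div]
        have := hy i hi'
        exact div_le_div_of_nonneg_right (by linarith) hs.le
    · intro i hi j hj hij
      by_contra hne
      have h := hsep i hi j hj hne
      simp only [f, Prod.mk.injEq] at hij
      have h1 := key _ _ (by linarith [hx i hi]) (by linarith [hx j hj]) hij.1
      have h2 := key _ _ (by linarith [hy i hi]) (by linarith [hy j hj]) hij.2
      have h3 : |x i - x j| < s / 2 := by
        rwa [show x i - a - (x j - a) = x i - x j by ring] at h1
      have h4 : |m * (x i - x j)| ≤ |x i - x j| := by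
        rw [abs_mul]; nlinarith [abs_nonneg (x i - x j)]
      have h5 : |y i - y j| < s := by
        have : y i - y j = (y i - m * x i - b - (y j - m * x j - b)) + m * (x i - x j) := by ring
        rw [this]
        calc _ ≤ _ := abs_add_le _ _
          _ < s := by linarith
      rcases le_max_iff.1 h with h | h <;> linarith
  rw [Finset.card_product, Finset.card_range, Finset.card_range] at hcard
  calc (S.card : ℝ) ≤ (((⌊2 * A / s⌋₊ + 1) * (⌊2 * B / s⌋₊ + 1) : ℕ) : ℝ) := by exact_mod_cast hcard
    _ ≤ _ := by
      push_cast
      gcongr <;> exact Nat.floor_le (by positivity)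

lemma WW_norm_max (w : WW) : ‖w‖ = max |w 0| |w 1| := by
    rw [Pi.norm_def]
    simp [Fin.univ_succ]

/-- points in a ball -/
lemma packing_ball {ι : Type*} (S : Finset ι) (v : ι → WW) (s ρ : ℝ) (c : WW) (hs : 0 < s)
    (hsep : ∀ i ∈ S, ∀ j ∈ S, i ≠ j → s ≤ ‖v i - v j‖) (hρ : 0 ≤ ρ)
    (h : ∀ i ∈ S, ‖v i - c‖ ≤ ρ) : (S.card : ℝ) ≤ (4 * ρ / s + 1) ^ 2 := by
  have := packing S (fun i => v i 0) (fun i => v i 1) s 0 (c 0 - ρ) (2 * ρ) (c 1 - ρ) (2 * ρ) hs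
    (by simp) (fun i hi j hj hij => by
      have := hsep i hi j hj hij
      rwa [WW_norm_max] at this)
    (fun i hi => by
      have h1 := (WW_abs_le _ 0).trans (h i hi)
      rw [Pi.sub_apply, abs_le] at h1
      constructor <;> linarith [h1.1, h1.2])
    (fun i hi => by
      have h1 := (WW_abs_le _ 1).trans (h i hi)
      rw [Pi.sub_apply, abs_le] at h1
      constructor <;> linarith [h1.1, h1.2]) (by positivity) (by positivity)
  calc _ ≤ _ := this
    _ = _ := by ring

/-- points in a ball and strip -/
lemma packing_strip {ι : Type*} (S : Finset ι) (v : ι → WW) (s ρ h : ℝ) (c v0 w : WW) (hs : 0 < s)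
    (hsep : ∀ i ∈ S, ∀ j ∈ S, i ≠ j → s ≤ ‖v i - v j‖) (hρ : 0 ≤ ρ) (hh : 0 ≤ h)
    (h1 : ∀ i ∈ S, ‖v i - c‖ ≤ ρ) (h2 : ∀ i ∈ S, ∃ l : ℝ, ‖v i - v0 - l • w‖ ≤ h) :
    (S.card : ℝ) ≤ (4 * ρ / s + 1) * (8 * h / s + 1) := by
  have main : ∀ a b : Fin 2, (∀ u : WW, ‖u‖ = max |u a| |u b|) → ‖w‖ = |w a| →
      (S.card : ℝ) ≤ (4 * ρ / s + 1) * (8 * h / s + 1) := by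
    intro a b hab hw
    set m := w b / w a with hm
    have hwb : w b = m * w a := by
      by_cases h0 : w a = 0
      · have := WW_abs_le w b
        rw [hw, h0] at this
        simp at this
        rw [this, h0]; simp
      · rw [hm]; field_simp
    have hm1 : |m| ≤ 1 := by
      rw [hm, abs_div]
      apply div_le_one_of_le₀ _ (abs_nonneg _)
      rw [← hw]; exact WW_abs_le w b
    have := packing S (fun i => v i a) (fun i => v i b) s m (c a - ρ) (2 * ρ)
      (v0 b - m * v0 a - 2 * h) (4 * h) hs hm1
      (fun i hi j hj hij => by
        have := hsep i hi j hj hij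
        rwa [hab] at this)
      (fun i hi => by
        have h1 := (WW_abs_le _ a).trans (h1 i hi)
        rw [Pi.sub_apply, abs_le] at h1
        constructor <;> linarith [h1.1, h1.2])
      (fun i hi => by
        obtain ⟨l, hl⟩ := h2 i hi
        have e1 := (WW_abs_le _ a).trans hl
        have e2 := (WW_abs_le _ b).trans hl
        simp only [Pi.sub_apply, Pi.smul_apply, smul_eq_mul] at e1 e2
        have e3 : |m * (v i a - v0 a - l * w a)| ≤ h := by
          rw [abs_mul]; nlinarith [abs_nonneg (v i a - v0 a - l * w a), abs_nonneg m]
        rw [hwb] at e2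
        rw [abs_le] at e2 e3
        constructor <;> linarith [e2.1, e2.2, e3.1, e3.2]) (by positivity) (by positivity)
    calc _ ≤ _ := this
      _ = _ := by ring
  rcases WW_norm_eq w with hw | hw
  · exact main 0 1 WW_norm_max hw
  · exact main 1 0 (fun u => by rw [max_comm]; exact WW_norm_max u) hw

lemma cauchy_meas {α ι : Type*} [MeasurableSpace α] (μ : Measure α) [IsFiniteMeasure μ]
    (S : Finset ι) (Y : ι → Set α) (hY : ∀ i ∈ S, MeasurableSet (Y i)) :
    (∑ i ∈ S, μ.real (Y i)) ^ 2 ≤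
      μ.real (⋃ i ∈ S, Y i) * ∑ i ∈ S, ∑ j ∈ S, μ.real (Y i ∩ Y j) := by
  classical
  set U := ⋃ i ∈ S, Y i with hU
  have hUm : MeasurableSet U := Finset.measurableSet_biUnion S hY
  let f : α → ℝ := fun x => ∑ i ∈ S, (Y i).indicator (fun _ => (1 : ℝ)) x
  have hIndInt : ∀ Z : Set α, MeasurableSet Z → Integrable (Z.indicator (fun _ => (1 : ℝ))) μ :=
    fun Z hZ => (integrable_const 1).indicator hZ
  have hval : ∀ Z : Set α, MeasurableSet Z → ∫ x, Z.indicator (fun _ => (1 : ℝ)) x ∂μ = μ.real Z := by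
    intro Z hZ
    rw [integral_indicator hZ]; simp
  have q : ∀ c : ℝ, 0 ≤ ∑ i ∈ S, ∑ j ∈ S, μ.real (Y i ∩ Y j) - 2 * c * (∑ i ∈ S, μ.real (Y i))
      + c ^ 2 * μ.real U := by
    intro c
    have e : ∀ x, (f x - c * U.indicator (fun _ => (1 : ℝ)) x) ^ 2 =
        (∑ i ∈ S, ∑ j ∈ S, (Y i ∩ Y j).indicator (fun _ => (1 : ℝ)) x)
        - 2 * c * (∑ i ∈ S, (Y i).indicator (fun _ => (1 : ℝ)) x)
        + c ^ 2 * U.indicator (fun _ => (1 : ℝ)) x := by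
      intro x
      have a1 : f x * U.indicator (fun _ => (1 : ℝ)) x = f x := by
        simp only [f, Finset.sum_mul]
        apply Finset.sum_congr rfl
        intro i hi
        by_cases hx : x ∈ Y i
        · have : x ∈ U := mem_biUnion hi hx
          simp [hx, this]
        · simp [hx]
      have a2 : U.indicator (fun _ => (1 : ℝ)) x ^ 2 = U.indicator (fun _ => (1 : ℝ)) x := by
        by_cases hx : x ∈ U <;> simp [hx]
      have a3 : f x ^ 2 = ∑ i ∈ S, ∑ j ∈ S, (Y i ∩ Y j).indicator (fun _ => (1 : ℝ)) x := by
        simp only [f, sq, Finset.sum_mul_sum]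
        apply Finset.sum_congr rfl; intro i _
        apply Finset.sum_congr rfl; intro j _
        by_cases hx : x ∈ Y i <;> by_cases hx' : x ∈ Y j <;> simp [hx, hx']
      have : (f x - c * U.indicator (fun _ => (1 : ℝ)) x) ^ 2 = f x ^ 2 -
        2 * c * (f x * U.indicator (fun _ => (1 : ℝ)) x) + c ^ 2 * (U.indicator (fun _ => (1 : ℝ)) x ^ 2) := by
        ring
      rw [this, a1, a2, a3]
    have hnn : 0 ≤ ∫ x, (f x - c * U.indicator (fun _ => (1 : ℝ)) x) ^ 2 ∂μ :=
      integral_nonneg fun x => sq_nonneg _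
    have i1 : Integrable (fun x => ∑ i ∈ S, ∑ j ∈ S, (Y i ∩ Y j).indicator (fun _ => (1 : ℝ)) x) μ :=
      integrable_finsetSum _ fun i hi => integrable_finsetSum _ fun j hj =>
        hIndInt _ ((hY i hi).inter (hY j hj))
    have i2 : Integrable (fun x => ∑ i ∈ S, (Y i).indicator (fun _ => (1 : ℝ)) x) μ :=
      integrable_finsetSum _ fun i hi => hIndInt _ (hY i hi)
    simp_rw [e] at hnn
    rw [integral_add (f := fun x => ∑ i ∈ S, ∑ j ∈ S, (Y i ∩ Y j).indicator (fun _ => (1 : ℝ)) x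
        - 2 * c * ∑ i ∈ S, (Y i).indicator (fun _ => (1 : ℝ)) x)
        (i1.sub (i2.const_mul _)) ((hIndInt _ hUm).const_mul _),
      integral_sub i1 (i2.const_mul _), integral_const_mul, integral_const_mul, hval U hUm,
      integral_finsetSum _ (fun i hi => hIndInt _ (hY i hi)),
      integral_finsetSum _ (fun i hi => integrable_finsetSum _ fun j hj =>
        hIndInt _ ((hY i hi).inter (hY j hj)))] at hnn
    have b1 : ∑ i ∈ S, ∫ x, (Y i).indicator (fun _ => (1 : ℝ)) x ∂μ = ∑ i ∈ S, μ.real (Y i) :=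
      Finset.sum_congr rfl fun i hi => hval _ (hY i hi)
    have b2 : ∑ i ∈ S, ∫ x, ∑ j ∈ S, (Y i ∩ Y j).indicator (fun _ => (1 : ℝ)) x ∂μ =
        ∑ i ∈ S, ∑ j ∈ S, μ.real (Y i ∩ Y j) := by
      apply Finset.sum_congr rfl; intro i hi
      rw [integral_finsetSum _ fun j hj => hIndInt _ ((hY i hi).inter (hY j hj))]
      exact Finset.sum_congr rfl fun j hj => hval _ ((hY i hi).inter (hY j hj))
    rw [b1, b2] at hnn
    exact hnn
  set A := ∑ i ∈ S, ∑ j ∈ S, μ.real (Y i ∩ Y j)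
  set B := ∑ i ∈ S, μ.real (Y i)
  have hU0 : 0 ≤ μ.real U := measureReal_nonneg
  have := discrim_le_zero (a := μ.real U) (b := -(2 * B)) (c := A)
    (fun x => by have := q x; nlinarith)
  rw [discrim] at this
  nlinarith

lemma dyadic_sum {ι : Type*} (ρ : ι → ℝ) (s D : ℝ) (hs : 0 < s) (n : ℕ) :
    ∀ (S : Finset ι), (∀ i ∈ S, s ≤ ρ i) → (∀ i ∈ S, ρ i < s * 2 ^ n) →
    (∀ x, s ≤ x → ((S.filter (fun i => ρ i ≤ x)).card : ℝ) ≤ D * x) →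
    ∑ i ∈ S, 1 / ρ i ≤ 2 * D * n := by
  induction n with
  | zero =>
    intro S h1 h2 h3
    have : S = ∅ := by
      apply Finset.eq_empty_of_forall_notMem
      intro i hi
      have := h1 i hi; have := h2 i hi
      simp at this; linarith
    simp [this]
  | succ n ih =>
    intro S h1 h2 h3
    have hD : 0 ≤ D := by
      have := h3 s le_rfl
      by_contra h
      push Not at h
      have : D * s < 0 := mul_neg_of_neg_of_pos h hs
      have : (0 : ℝ) ≤ ((S.filter (fun i => ρ i ≤ s)).card : ℝ) := by positivity
      linarith
    rw [← Finset.sum_filter_add_sum_filter_not S (fun i => ρ i < s * 2 ^ n)]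
    have a := ih (S.filter (fun i => ρ i < s * 2 ^ n)) (fun i hi => h1 i (Finset.mem_filter.1 hi).1)
      (fun i hi => (Finset.mem_filter.1 hi).2) (fun x hx => by
        refine le_trans ?_ (h3 x hx)
        gcongr
        exact Finset.filter_subset _ _)
    have b : ∑ i ∈ S.filter (fun i => ¬ ρ i < s * 2 ^ n), 1 / ρ i ≤ 2 * D := by
      have hcard := h3 (s * 2 ^ (n + 1)) (by
        have : (1 : ℝ) ≤ 2 ^ (n + 1) := one_le_pow₀ (by norm_num)
        nlinarith)
      have hsub : S.filter (fun i => ¬ ρ i < s * 2 ^ n) ⊆ S.filter (fun i => ρ i ≤ s * 2 ^ (n + 1)) := by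
        intro i hi
        rw [Finset.mem_filter] at *
        exact ⟨hi.1, (h2 i hi.1).le⟩
      have hpos : 0 < s * 2 ^ n := by positivity
      calc _ ≤ ∑ i ∈ S.filter (fun i => ¬ ρ i < s * 2 ^ n), 1 / (s * 2 ^ n) := by
            apply Finset.sum_le_sum
            intro i hi
            rw [Finset.mem_filter] at hi
            apply one_div_le_one_div_of_le hpos
            linarith [hi.2]
        _ = ((S.filter (fun i => ¬ ρ i < s * 2 ^ n)).card : ℝ) * (1 / (s * 2 ^ n)) := by
            rw [Finset.sum_const, nsmul_eq_mul]
        _ ≤ (D * (s * 2 ^ (n + 1))) * (1 / (s * 2 ^ n)) := by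
            gcongr
            refine le_trans ?_ hcard
            exact_mod_cast Finset.card_le_card hsub
        _ = 2 * D := by field_simp; ring
    push_cast
    linarith

lemma hairbrush {ι : Type*} (H : Finset ι) (p v : ι → WW) (p0 v0 : WW) (Y : ι → Set XX) (τ : ι → ℝ)
    (r κ : ℝ) (Λ : ℕ) (hr : 0 < r) (hκ : 0 < κ) (hκ1 : κ ≤ 1) (hΛ : 1 / r ≤ 2 ^ Λ) (hΛ1 : 1 ≤ Λ)
    (hv : ∀ i ∈ H, ‖v i‖ ≤ 2) (hsep : ∀ i ∈ H, ∀ j ∈ H, i ≠ j → r / 9 ≤ ‖v i - v j‖)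
    (hYm : ∀ i ∈ H, MeasurableSet (Y i)) (hYs : ∀ i ∈ H, Y i ⊆ sbox 0 1 (p i) (v i) r)
    (hmass : ∀ i ∈ H, κ * r ^ 2 ≤ volume.real (Y i))
    (hτ : ∀ i ∈ H, ‖(p i - p0) + τ i • (v i - v0)‖ ≤ 2 * r) :
    (H.card : ℝ) * κ ^ 3 * r ^ 2 ≤ 280000000 * Λ * volume.real (⋃ i ∈ H, Y i) := by
  classical
  set η := κ / 16 with hη
  have hηp : 0 < η := by positivity
  let Z : ι → Set XX := fun i => Y i \ sbox (τ i) η (p i) (v i) r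
  have hZm : ∀ i ∈ H, MeasurableSet (Z i) := fun i hi => (hYm i hi).diff (sbox_meas _ _ _ _ _)
  have hZY : ∀ i, Z i ⊆ Y i := fun i => sdiff_subset
  have hYfin : ∀ i ∈ H, volume (Y i) ≠ ∞ := fun i hi =>
    ((measure_mono (hYs i hi)).trans_lt (sbox_volume_ne_top _ _ _ _ _ hr.le).lt_top).ne
  have hZmass : ∀ i ∈ H, κ * r ^ 2 / 2 ≤ volume.real (Z i) := by
    intro i hi
    have h1 : volume.real (Y i) ≤ volume.real (Z i) + volume.real (sbox (τ i) η (p i) (v i) r) := by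
      refine le_trans (measureReal_mono (s₂ := Z i ∪ sbox (τ i) η (p i) (v i) r) ?_ ?_)
        (measureReal_union_le _ _)
      · intro z hz
        by_cases h : z ∈ sbox (τ i) η (p i) (v i) r
        · exact Or.inr h
        · exact Or.inl ⟨hz, h⟩
      · exact (measure_union_lt_top ((measure_mono (hZY i)).trans_lt (hYfin i hi).lt_top)
          (sbox_volume_ne_top _ _ _ _ _ hr.le).lt_top).ne
    rw [sbox_real _ _ _ _ _ hηp.le hr.le] at h1
    have h2 := hmass i hi
    rw [hη] at h1
    nlinarith
  -- strip property
  have hstrip : ∀ i ∈ H, ∀ j ∈ H, (Z i ∩ Z j).Nonempty →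
      ∃ l : ℝ, ‖v j - v0 - l • (v i - v0)‖ ≤ 6 * r / η := by
    rintro i hi j hj ⟨z, ⟨hzi, hzi'⟩, ⟨hzj, hzj'⟩⟩
    have bi := (hYs i hi hzi).2
    have bj := (hYs j hj hzj).2
    have hfar : η < |z.1 - τ j| := by
      by_contra h
      exact hzj' ⟨not_lt.1 h, bj⟩
    have hne : z.1 - τ j ≠ 0 := by
      intro h; rw [h] at hfar; simp at hfar; linarith
    refine ⟨(z.1 - τ i) / (z.1 - τ j), ?_⟩
    have e : ‖(z.1 - τ j) • (v j - v0) - (z.1 - τ i) • (v i - v0)‖ ≤ 6 * r := by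
      have : (z.1 - τ j) • (v j - v0) - (z.1 - τ i) • (v i - v0) =
          (z.2 - p i - z.1 • v i) - (z.2 - p j - z.1 • v j)
          + ((p i - p0) + τ i • (v i - v0)) - ((p j - p0) + τ j • (v j - v0)) := by
        ext c; simp; ring
      rw [this]
      calc _ ≤ _ := norm_sub_le _ _
        _ ≤ _ := add_le_add_left (norm_add_le _ _) _
        _ ≤ _ := add_le_add_left (add_le_add_left (norm_sub_le _ _) _) _
        _ ≤ 6 * r := by linarith [hτ i hi, hτ j hj]
    rw [le_div_iff₀ hηp]
    have e2 : (z.1 - τ j) • (v j - v0) - (z.1 - τ i) • (v i - v0) =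
        (z.1 - τ j) • (v j - v0 - ((z.1 - τ i) / (z.1 - τ j)) • (v i - v0)) := by
      rw [smul_sub (z.1 - τ j) (v j - v0), smul_smul, mul_div_cancel₀ _ hne]
    rw [e2, norm_smul, Real.norm_eq_abs] at e
    nlinarith [norm_nonneg (v j - v0 - ((z.1 - τ i) / (z.1 - τ j)) • (v i - v0))]
  -- pair sums
  have hpair : ∀ i ∈ H, ∑ j ∈ H, volume.real (Z i ∩ Z j) ≤ 70000000 * Λ * r ^ 2 / κ := by
    intro i hi
    set S := (H.erase i).filter (fun j => (Z i ∩ Z j).Nonempty) with hS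
    have hSH : ∀ j ∈ S, j ∈ H ∧ j ≠ i ∧ (Z i ∩ Z j).Nonempty := by
      intro j hj
      rw [hS, Finset.mem_filter, Finset.mem_erase] at hj
      exact ⟨hj.1.2, hj.1.1, hj.2⟩
    have h1 : ∑ j ∈ S, 1 / ‖v j - v i‖ ≤ 2 * (311085 / (r * κ)) * ((Λ + 6 : ℕ) : ℝ) := by
      apply dyadic_sum (fun j => ‖v j - v i‖) (r / 9) _ (by positivity)
      · intro j hj
        exact hsep j (hSH j hj).1 i hi (hSH j hj).2.1
      · intro j hj
        have h4 : ‖v j - v i‖ ≤ 4 := (norm_sub_le _ _).trans (by linarith [hv j (hSH j hj).1, hv i hi])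
        rw [div_le_iff₀ hr] at hΛ
        rw [pow_add]
        nlinarith
      · intro x hx
        have := packing_strip (S.filter (fun j => ‖v j - v i‖ ≤ x)) v (r / 9) x (6 * r / η) (v i) v0
          (v i - v0) (by positivity)
          (fun j hj k hk hjk => hsep j (hSH j (Finset.mem_filter.1 hj).1).1 k
            (hSH k (Finset.mem_filter.1 hk).1).1 hjk) (by linarith) (by positivity)
          (fun j hj => (Finset.mem_filter.1 hj).2)
          (fun j hj => hstrip i hi j (hSH j (Finset.mem_filter.1 hj).1).1
            (hSH j (Finset.mem_filter.1 hj).1).2.2)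
        refine this.trans ?_
        have e1 : 4 * x / (r / 9) + 1 ≤ 45 * x / r := by
          rw [div_div_eq_mul_div, div_add_one hr.ne']
          gcongr; linarith
        have e2 : 8 * (6 * r / η) / (r / 9) + 1 ≤ 6913 / κ := by
          have : 8 * (6 * r / η) / (r / 9) = 6912 / κ := by
            rw [hη]; field_simp; norm_num
          rw [this, div_add_one hκ.ne']
          gcongr; linarith
        calc _ ≤ (45 * x / r) * (6913 / κ) := by
              apply mul_le_mul e1 e2 (by positivity)
              have : 0 < x := lt_of_lt_of_le (by positivity) hx
              positivity
          _ = _ := by field_simp; ring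
    have h2 : ∑ j ∈ H.erase i, volume.real (Z i ∩ Z j) ≤ ∑ j ∈ S, 16 * r ^ 3 * (1 / ‖v j - v i‖) := by
      rw [hS, Finset.sum_filter]
      apply Finset.sum_le_sum
      intro j hj
      rw [Finset.mem_erase] at hj
      split_ifs with h
      · have hd := hsep j hj.2 i hi hj.1
        have hpos : 0 < ‖v i - v j‖ := by rw [norm_sub_rev]; linarith
        have := sbox_inter 0 0 1 1 (p i) (v i) (p j) (v j) r hr.le hpos
        rw [norm_sub_rev] at this
        rw [mul_one_div]
        refine le_trans (measureReal_mono ?_ ?_) this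
        · exact inter_subset_inter ((hZY i).trans (hYs i hi)) ((hZY j).trans (hYs j hj.2))
        · exact ((measure_mono inter_subset_left).trans_lt
            (sbox_volume_ne_top _ _ _ _ _ hr.le).lt_top).ne
      · rw [not_nonempty_iff_eq_empty] at h
        simp [h]
    have h3 : volume.real (Z i ∩ Z i) ≤ 8 * r ^ 2 := by
      refine le_trans (measureReal_mono (s₂ := sbox 0 1 (p i) (v i) r) ?_
        (sbox_volume_ne_top _ _ _ _ _ hr.le)) ?_
      · exact inter_subset_left.trans ((hZY i).trans (hYs i hi))
      · rw [sbox_real _ _ _ _ _ zero_le_one hr.le]; linarith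
    rw [← Finset.add_sum_erase H _ hi]
    rw [← Finset.mul_sum] at h2
    have h4 : 16 * r ^ 3 * ∑ j ∈ S, 1 / ‖v j - v i‖ ≤
        16 * r ^ 3 * (2 * (311085 / (r * κ)) * ((Λ + 6 : ℕ) : ℝ)) := by gcongr
    have h5 : 16 * r ^ 3 * (2 * (311085 / (r * κ)) * ((Λ + 6 : ℕ) : ℝ)) =
        (9954720 * (Λ + 6)) * r ^ 2 / κ := by
      push_cast; field_simp; ring
    have h6 : 8 * r ^ 2 ≤ 8 * r ^ 2 / κ := by
      rw [le_div_iff₀ hκ]; nlinarith [sq_nonneg r]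
    have hL : (1 : ℝ) ≤ Λ := by exact_mod_cast hΛ1
    calc _ ≤ 8 * r ^ 2 / κ + (9954720 * (Λ + 6)) * r ^ 2 / κ := by linarith
      _ = (8 + 9954720 * (Λ + 6)) * r ^ 2 / κ := by ring
      _ ≤ _ := by gcongr; linarith
  -- Cauchy-Schwarz
  set B := ⋃ i ∈ H, sbox 0 1 (p i) (v i) r with hB
  have hBfin : volume B < ∞ := by
    refine measure_biUnion_lt_top H.finite_toSet ?_
    intro i _
    exact (sbox_volume_ne_top _ _ _ _ _ hr.le).lt_top
  have : IsFiniteMeasure (volume.restrict B) := ⟨by simpa using hBfin⟩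
  have hres : ∀ A : Set XX, A ⊆ B → (volume.restrict B).real A = volume.real A := by
    intro A hA
    rw [measureReal_def, measureReal_def, Measure.restrict_eq_self _ hA]
  have hZB : ∀ i ∈ H, Z i ⊆ B := fun i hi =>
    ((hZY i).trans (hYs i hi)).trans (subset_biUnion_of_mem (u := fun i => sbox 0 1 (p i) (v i) r) hi)
  have hcs := cauchy_meas (volume.restrict B) H Z hZm
  rw [hres _ (iUnion₂_subset hZB)] at hcs
  have c1 : (H.card : ℝ) * (κ * r ^ 2 / 2) ≤ ∑ i ∈ H, (volume.restrict B).real (Z i) := by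
    rw [← nsmul_eq_mul]
    apply Finset.card_nsmul_le_sum
    intro i hi
    rw [hres _ (hZB i hi)]; exact hZmass i hi
  have c2 : ∑ i ∈ H, ∑ j ∈ H, (volume.restrict B).real (Z i ∩ Z j) ≤
      H.card * (70000000 * Λ * r ^ 2 / κ) := by
    rw [← nsmul_eq_mul]
    apply Finset.sum_le_card_nsmul
    intro i hi
    refine le_trans (le_of_eq ?_) (hpair i hi)
    apply Finset.sum_congr rfl
    intro j hj
    rw [hres _ (inter_subset_left.trans (hZB i hi))]
  have c3 : volume.real (⋃ i ∈ H, Z i) ≤ volume.real (⋃ i ∈ H, Y i) := by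
    apply measureReal_mono
    · exact iUnion₂_mono fun i _ => hZY i
    · exact ((measure_mono (iUnion₂_mono fun i hi => hYs i hi)).trans_lt hBfin).ne
  set V := volume.real (⋃ i ∈ H, Y i)
  have hV : 0 ≤ V := measureReal_nonneg
  have c4 : ((H.card : ℝ) * (κ * r ^ 2 / 2)) ^ 2 ≤ V * (H.card * (70000000 * Λ * r ^ 2 / κ)) := by
    calc _ ≤ (∑ i ∈ H, (volume.restrict B).real (Z i)) ^ 2 := by gcongr
      _ ≤ _ := hcs
      _ ≤ _ := by
        apply mul_le_mul c3 c2 _ hV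
        exact Finset.sum_nonneg fun i _ => Finset.sum_nonneg fun j _ => measureReal_nonneg
  rcases Nat.eq_zero_or_pos H.card with h0 | h0
  · rw [h0]; simp; positivity
  · have hn : (0 : ℝ) < H.card := by exact_mod_cast h0
    have hfac : 0 < (H.card : ℝ) * r ^ 2 / (4 * κ) := by positivity
    apply le_of_mul_le_mul_left _ hfac
    calc _ = ((H.card : ℝ) * (κ * r ^ 2 / 2)) ^ 2 := by field_simp; ring
      _ ≤ _ := c4
      _ = _ := by field_simp; ring

/-- bipartite refinement -/
lemma refine_tubes {P ι : Type*} [Fintype P] [Fintype ι] [DecidableEq ι] (w : P → ℝ)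
    (hw : ∀ x, 0 ≤ w x) (inc : P → Finset ι) (I κ : ℝ) (hI : I = ∑ x, w x * (inc x).card)
    (hκ0 : 0 ≤ κ) (hκ : κ * Fintype.card ι ≤ I / 4) :
    ∃ S : Finset ι,
      (∀ i ∈ S, κ ≤ ∑ x, if (inc x).card ≤ 4 * (inc x ∩ S).card ∧ i ∈ inc x then w x else 0) ∧
      I / 2 ≤ ∑ x, if (inc x).card ≤ 4 * (inc x ∩ S).card then w x * (inc x ∩ S).card else 0 := by
  let g : Finset ι → P → ℝ := fun S x => max 0 (((inc x ∩ S).card : ℝ) - (inc x).card / 4)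
  let Φ : Finset ι → ℝ := fun S => ∑ x, w x * g S x - κ * S.card
  obtain ⟨S, -, hS⟩ := Finset.exists_max_image (Finset.univ : Finset (Finset ι)) Φ ⟨∅, by simp⟩
  refine ⟨S, ?_, ?_⟩
  · intro i hi
    have h := hS (S.erase i) (by simp)
    simp only [Φ] at h
    have hc : ((S.erase i).card : ℝ) = S.card - 1 := by
      rw [Finset.card_erase_of_mem hi, Nat.cast_sub (Finset.card_pos.2 ⟨i, hi⟩)]; simp
    rw [hc] at h
    have h2 : ∑ x, w x * g S x - ∑ x, w x * g (S.erase i) x ≤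
        ∑ x, if (inc x).card ≤ 4 * (inc x ∩ S).card ∧ i ∈ inc x then w x else 0 := by
      rw [← Finset.sum_sub_distrib]
      apply Finset.sum_le_sum
      intro x _
      have hsub : (inc x ∩ S.erase i).card ≤ (inc x ∩ S).card :=
        Finset.card_le_card (Finset.inter_subset_inter_left (Finset.erase_subset _ _))
      have hsub' : ((inc x ∩ S.erase i).card : ℝ) ≤ (inc x ∩ S).card := by exact_mod_cast hsub
      rw [← mul_sub]
      split_ifs with hx
      · have : g S x - g (S.erase i) x ≤ 1 := by
          have h3 : (inc x ∩ S).card ≤ (inc x ∩ S.erase i).card + 1 := by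
            have : inc x ∩ S.erase i = (inc x ∩ S).erase i := by ext j; simp; tauto
            rw [this]
            have := Finset.pred_card_le_card_erase (s := inc x ∩ S) (a := i)
            omega
          have h3' : ((inc x ∩ S).card : ℝ) ≤ (inc x ∩ S.erase i).card + 1 := by exact_mod_cast h3
          simp only [g]
          have := le_max_right 0 (((inc x ∩ S.erase i).card : ℝ) - (inc x).card / 4)
          have := le_max_left 0 (((inc x ∩ S.erase i).card : ℝ) - (inc x).card / 4)
          rcases max_choice 0 (((inc x ∩ S).card : ℝ) - (inc x).card / 4) with h | h <;> rw [h] <;>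
            linarith
        nlinarith [hw x]
      · have : g S x - g (S.erase i) x ≤ 0 := by
          rw [not_and_or] at hx
          rcases hx with hx | hx
          · have : ((inc x ∩ S).card : ℝ) - (inc x).card / 4 ≤ 0 := by
              push Not at hx
              have : (4 : ℝ) * (inc x ∩ S).card < (inc x).card := by exact_mod_cast hx
              linarith
            simp only [g]
            rw [max_eq_left this]
            linarith [le_max_left 0 (((inc x ∩ S.erase i).card : ℝ) - (inc x).card / 4)]
          · have : inc x ∩ S.erase i = inc x ∩ S := by
              ext j
              simp only [Finset.mem_inter, Finset.mem_erase]
              constructor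
              · rintro ⟨a, _, b⟩; exact ⟨a, b⟩
              · rintro ⟨a, b⟩; exact ⟨a, fun h => hx (h ▸ a), b⟩
            simp only [g]
            rw [this]; simp
        nlinarith [hw x]
    linarith
  · have h := hS Finset.univ (by simp)
    simp only [Φ, Finset.card_univ] at h
    have h1 : ∑ x, w x * g Finset.univ x = 3 / 4 * I := by
      rw [hI, Finset.mul_sum]
      apply Finset.sum_congr rfl
      intro x _
      simp only [g, Finset.inter_univ]
      rw [max_eq_right]
      · ring
      · have : (0 : ℝ) ≤ (inc x).card := by positivity
        linarith
    have h2 : ∑ x, w x * g S x ≤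
        ∑ x, if (inc x).card ≤ 4 * (inc x ∩ S).card then w x * (inc x ∩ S).card else 0 := by
      apply Finset.sum_le_sum
      intro x _
      split_ifs with hx
      · gcongr
        · exact hw x
        simp only [g]
        apply max_le (by positivity)
        have : (0 : ℝ) ≤ (inc x).card := by positivity
        linarith
      · have : ((inc x ∩ S).card : ℝ) - (inc x).card / 4 ≤ 0 := by
          push Not at hx
          have : (4 : ℝ) * (inc x ∩ S).card < (inc x).card := by exact_mod_cast hx
          linarith
        simp only [g]
        rw [max_eq_left this]; simp
    have : 0 ≤ κ * S.card := by positivity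
    linarith

lemma cap_select {ι : Type*} [DecidableEq ι] (d : ι → ι → ℝ) (θ : ℕ → ℝ) (L : ℕ)
    (hd0 : ∀ i j, d i j ≤ θ 0)
    (A : Finset ι) (hA : A.Nonempty) :
    ∃ k ≤ L, ∃ c ∈ A, (A.card : ℝ) ≤ 32 ^ L * (A.filter (fun j => d c j ≤ θ k)).card ∧
      (k < L → ∀ i ∈ A, 32 * (A.filter (fun j => d i j ≤ θ (k + 1))).card ≤
        (A.filter (fun j => d c j ≤ θ k)).card) := by
  obtain ⟨⟨c, k⟩, hm, hmax⟩ := Finset.exists_max_image (A ×ˢ Finset.range (L + 1))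
    (fun q => 32 ^ q.2 * (A.filter (fun j => d q.1 j ≤ θ q.2)).card)
    (hA.product ⟨0, by simp⟩)
  simp only [Finset.mem_product, Finset.mem_range] at hm hmax
  refine ⟨k, by omega, c, hm.1, ?_, ?_⟩
  · have h := hmax (c, 0) ⟨hm.1, by simp⟩
    simp only [pow_zero, one_mul, hd0, Finset.filter_true] at h
    have h2 : 32 ^ k * (A.filter (fun j => d c j ≤ θ k)).card ≤
        32 ^ L * (A.filter (fun j => d c j ≤ θ k)).card := by
      gcongr
      · norm_num
      · omega
    exact_mod_cast h.trans h2
  · intro hk i hi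
    have h := hmax (i, k + 1) ⟨hi, by simpa using hk⟩
    simp only [pow_succ] at h
    have : 0 < 32 ^ k := by positivity
    rw [mul_assoc] at h
    exact Nat.le_of_mul_le_mul_left h this

lemma comb {P ι : Type*} [Fintype P] [Fintype ι] [DecidableEq ι] [Nonempty ι] (w : P → ℝ)
    (hw : ∀ x, 0 ≤ w x) (inc : P → Finset ι) (d : ι → ι → ℝ) (θ : ℕ → ℝ) (L m : ℕ)
    (hd0 : ∀ i j, d i j ≤ θ 0) (hsym : ∀ i j, d i j = d j i)
    (htri : ∀ i j k, d i k ≤ d i j + d j k)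
    (hm : Fintype.card ι < 2 ^ m) (mbar : ℝ) (hmbar : ∀ i, ∑ x, (if i ∈ inc x then w x else 0) = mbar)
    (γ : ℝ) (hγ : γ = 1 / (32 ^ L * ((L + 1) * m))) :
    ∃ k ≤ L, ∃ N : ℕ, 0 < N ∧ ∃ (S : Finset ι) (S2 : P → Finset ι),
      (∀ x, S2 x ⊆ inc x ∧ S2 x ⊆ S) ∧
      (∀ x, (S2 x).Nonempty → N ≤ 4 * (S2 x).card ∧ (S2 x).card ≤ 2 * N) ∧
      (∀ x, ∀ i ∈ S2 x, ∀ j ∈ S2 x, d i j ≤ 2 * θ k) ∧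
      (k < L → ∀ x, ∀ i ∈ S2 x, 16 * ((S2 x).filter (fun j => d i j ≤ θ (k + 1))).card ≤ N) ∧
      (∀ i ∈ S, γ * mbar / 4 ≤ ∑ x, if i ∈ S2 x then w x else 0) ∧
      γ * Fintype.card ι * mbar / 2 ≤ ∑ x, w x * (S2 x).card := by
  classical
  have hsel : ∀ x, ∃ k ≤ L, ∃ S1 : Finset ι, S1 ⊆ inc x ∧ ((inc x).card : ℝ) ≤ 32 ^ L * S1.card ∧
      (∀ i ∈ S1, ∀ j ∈ S1, d i j ≤ 2 * θ k) ∧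
      (k < L → ∀ i ∈ inc x, 32 * ((inc x).filter (fun j => d i j ≤ θ (k + 1))).card ≤ S1.card) := by
    intro x
    rcases (inc x).eq_empty_or_nonempty with h | h
    · exact ⟨0, Nat.zero_le _, ∅, by simp, by simp [h], by simp, by simp [h]⟩
    · obtain ⟨k, hk, c, hc, h1, h2⟩ := cap_select d θ L hd0 (inc x) h
      refine ⟨k, hk, _, Finset.filter_subset _ _, h1, ?_, h2⟩
      intro i hi j hj
      have a := (Finset.mem_filter.1 hi).2
      have b := (Finset.mem_filter.1 hj).2
      have := htri i c j
      rw [hsym i c] at this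
      linarith
  choose kf hkL S1 hS1 hS1c hS1d hS1b using hsel
  -- pigeonhole
  let cls : P → ℕ × ℕ := fun x => (kf x, Nat.log 2 (S1 x).card)
  set T := Finset.range (L + 1) ×ˢ Finset.range m with hT
  have hmpos : 0 < m := by
    rcases Nat.eq_zero_or_pos m with h | h
    · rw [h] at hm
      have : 0 < Fintype.card ι := Fintype.card_pos
      simp at hm
    · exact h
  have hmaps : ∀ x, cls x ∈ T := by
    intro x
    simp only [cls, hT, Finset.mem_product, Finset.mem_range]
    refine ⟨by have := hkL x; omega, ?_⟩
    apply Nat.log_lt_of_lt_pow' hmpos.ne'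
    exact (Finset.card_le_univ _).trans_lt hm
  set I0 := ∑ x, w x * (S1 x).card with hI0
  have hTcard : (T.card : ℝ) = (L + 1) * m := by
    rw [hT, Finset.card_product]; simp
  have hTpos : (0 : ℝ) < (L + 1) * m := by positivity
  obtain ⟨⟨k, e⟩, hke, hpig⟩ : ∃ q ∈ T, I0 / ((L + 1) * m) ≤
      ∑ x with cls x = q, w x * (S1 x).card := by
    apply Finset.exists_le_sum_fiber_of_maps_to_of_nsmul_le_sum (fun x _ => hmaps x)
    · rw [hT]
      exact Finset.Nonempty.product ⟨0, by simp⟩ ⟨0, by simpa using hmpos⟩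
    · rw [nsmul_eq_mul, hTcard, mul_div_cancel₀ _ hTpos.ne']
  simp only [hT, Finset.mem_product, Finset.mem_range] at hke
  let inc1 : P → Finset ι := fun x => if cls x = (k, e) then S1 x else ∅
  set I := ∑ x, w x * (inc1 x).card with hI
  have hIeq : I = ∑ x with cls x = (k, e), w x * (S1 x).card := by
    rw [hI, Finset.sum_filter]
    apply Finset.sum_congr rfl
    intro x _
    simp only [inc1]
    split_ifs <;> simp
  have hMm : ∑ x, w x * (inc x).card = Fintype.card ι * mbar := by
    have : ∀ x, w x * (inc x).card = ∑ i, if i ∈ inc x then w x else 0 := by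
      intro x
      rw [Finset.sum_ite_mem]; simp [mul_comm]
    simp_rw [this]
    rw [Finset.sum_comm]
    simp_rw [hmbar]
    simp
  have hI1 : γ * Fintype.card ι * mbar ≤ I := by
    have a : Fintype.card ι * mbar ≤ 32 ^ L * I0 := by
      rw [← hMm, hI0, Finset.mul_sum]
      apply Finset.sum_le_sum
      intro x _
      have := hS1c x
      nlinarith [hw x]
    rw [hIeq]
    refine le_trans ?_ hpig
    rw [hγ, mul_assoc, div_mul_eq_mul_div, one_mul, div_le_div_iff₀ (by positivity) hTpos]
    nlinarith
  have hMpos : (0 : ℝ) < Fintype.card ι := by exact_mod_cast Fintype.card_pos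
  have hmb : 0 ≤ mbar := by
    rw [← hmbar (Classical.arbitrary ι)]
    exact Finset.sum_nonneg fun x _ => by split_ifs <;> simp [hw]
  have hγ0 : 0 ≤ γ := by rw [hγ]; positivity
  obtain ⟨S, hSa, hSb⟩ := refine_tubes w hw inc1 I (γ * mbar / 4) hI (by positivity) (by nlinarith)
  let S2 : P → Finset ι := fun x => if (inc1 x).card ≤ 4 * (inc1 x ∩ S).card then inc1 x ∩ S else ∅
  have hS2 : ∀ x, ∀ i ∈ S2 x, cls x = (k, e) ∧ i ∈ S1 x ∧ i ∈ S ∧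
      (S1 x).card ≤ 4 * (S2 x).card := by
    intro x i hi
    simp only [S2] at hi ⊢
    split_ifs at hi ⊢ with h
    · rw [Finset.mem_inter] at hi
      have hi1 := hi.1
      simp only [inc1] at hi1
      split_ifs at hi1 with hc
      · refine ⟨hc, hi1, hi.2, ?_⟩
        have : inc1 x = S1 x := by simp [inc1, hc]
        rw [this] at h ⊢
        exact h
      · simp at hi1
    · simp at hi
  have hS2S1 : ∀ x, S2 x ⊆ S1 x := fun x i hi => (hS2 x i hi).2.1
  refine ⟨k, by omega, 2 ^ e, by positivity, S, S2, ?_, ?_, ?_, ?_, ?_, ?_⟩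
  · intro x
    exact ⟨fun i hi => hS1 x (hS2S1 x hi), fun i hi => (hS2 x i hi).2.2.1⟩
  · rintro x ⟨i, hi⟩
    obtain ⟨hc, h1, h2, h3⟩ := hS2 x i hi
    simp only [cls, Prod.mk.injEq] at hc
    have hne : (S1 x).card ≠ 0 := (Finset.card_pos.2 ⟨i, h1⟩).ne'
    have b1 := Nat.pow_log_le_self 2 hne
    have b2 := Nat.lt_pow_succ_log_self (b := 2) (by norm_num) (S1 x).card
    rw [hc.2] at b1 b2
    have b3 := Finset.card_le_card (hS2S1 x)
    rw [pow_succ] at b2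
    omega
  · intro x i hi j hj
    have hc := (hS2 x i hi).1
    simp only [cls, Prod.mk.injEq] at hc
    rw [← hc.1]
    exact hS1d x i (hS2S1 x hi) j (hS2S1 x hj)
  · intro hk x i hi
    obtain ⟨hc, h1, h2, h3⟩ := hS2 x i hi
    simp only [cls, Prod.mk.injEq] at hc
    have b2 := Nat.lt_pow_succ_log_self (b := 2) (by norm_num) (S1 x).card
    rw [hc.2, pow_succ] at b2
    have b := hS1b x (by rw [hc.1]; exact hk) i (hS1 x h1)
    rw [hc.1] at b
    have b4 : ((S2 x).filter (fun j => d i j ≤ θ (k + 1))).card ≤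
        ((inc x).filter (fun j => d i j ≤ θ (k + 1))).card :=
      Finset.card_le_card (Finset.filter_subset_filter _ ((hS2S1 x).trans (hS1 x)))
    omega
  · intro i hi
    refine (hSa i hi).trans (le_of_eq ?_)
    apply Finset.sum_congr rfl
    intro x _
    simp only [S2]
    by_cases h : (inc1 x).card ≤ 4 * (inc1 x ∩ S).card
    · simp [h, hi]
    · simp [h]
  · refine le_trans ?_ (hSb.trans (le_of_eq ?_))
    · linarith
    · apply Finset.sum_congr rfl
      intro x _
      simp only [S2]
      split_ifs <;> simp

lemma exists_separated {ι : Type*} [DecidableEq ι] (S : Finset ι) (d : ι → ι → ℝ) (ρ : ℝ)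
    (hsym : ∀ i j, d i j = d j i) (hd : ∀ i, d i i ≤ ρ) :
    ∃ D ⊆ S, (∀ i ∈ D, ∀ j ∈ D, i ≠ j → ρ < d i j) ∧ ∀ i ∈ S, ∃ j ∈ D, d i j ≤ ρ := by
  obtain ⟨D, hD, hmax⟩ := Finset.exists_max_image
    (S.powerset.filter (fun D => ∀ i ∈ D, ∀ j ∈ D, i ≠ j → ρ < d i j)) Finset.card
    ⟨∅, by simp⟩
  rw [Finset.mem_filter, Finset.mem_powerset] at hD
  refine ⟨D, hD.1, hD.2, ?_⟩
  intro i hi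
  by_contra! hcon
  have hiD : i ∉ D := fun h => absurd (hcon i h) (not_lt.2 (hd i))
  have := hmax (insert i D) (by
    rw [Finset.mem_filter, Finset.mem_powerset]
    refine ⟨Finset.insert_subset hi hD.1, ?_⟩
    intro a ha b hb hab
    rw [Finset.mem_insert] at ha hb
    rcases ha with rfl | ha <;> rcases hb with rfl | hb
    · exact absurd rfl hab
    · exact hcon b hb
    · rw [hsym]; exact hcon a ha
    · exact hD.2 a ha b hb hab)
  rw [Finset.card_insert_of_notMem hiD] at this
  omega

set_option maxHeartbeats 2000000 in
lemma core_exact {ι : Type*} [Fintype ι] [Nonempty ι] (p v : ι → WW) (Y : ι → Set XX)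
    (r lam K γ : ℝ) (L m Λ : ℕ) (hr : 0 < r) (hr1 : r ≤ 1) (hl : 0 < lam) (hl1 : lam ≤ 1) (hK : 1 ≤ K)
    (hL : 4 / K ^ L ≤ r) (hL' : ∀ k < L, r < 4 / K ^ k) (hm : Fintype.card ι < 2 ^ m)
    (hΛ : 1 / r ≤ 2 ^ Λ) (hΛ1 : 1 ≤ Λ) (hγ : γ = 1 / (32 ^ L * ((L + 1) * m)))
    (hv : ∀ i, ‖v i‖ ≤ 2) (hsep : ∀ i j, i ≠ j → r / 9 ≤ ‖v i - v j‖)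
    (hYm : ∀ i, MeasurableSet (Y i)) (hYs : ∀ i, Y i ⊆ sbox 0 1 (p i) (v i) r)
    (hmass : ∀ i, volume.real (Y i) = lam * r ^ 2) :
    γ ^ 11 * lam ^ 10 * (Fintype.card ι * r ^ 2) ^ 3 * r ^ 2 ≤
      (32 * 217 ^ 2 * 4 ^ 8 * 35840000000 ^ 2) * (K * Λ) ^ 2 * (volume.real (⋃ i, Y i)) ^ 4 := by
  classical
  set V := volume.real (⋃ i, Y i) with hV
  set M : ℝ := (Fintype.card ι : ℝ) with hM
  have hV0 : 0 ≤ V := measureReal_nonneg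
  have hM1 : 1 ≤ M := by rw [hM]; exact_mod_cast Fintype.card_pos
  have hmpos : 0 < m := by
    rcases Nat.eq_zero_or_pos m with h | h
    · rw [h] at hm
      have : 0 < Fintype.card ι := Fintype.card_pos
      simp at hm
    · exact h
  have hLm : (1 : ℝ) ≤ 32 ^ L * ((L + 1) * m) := by
    have h1 : (1 : ℝ) ≤ 32 ^ L := one_le_pow₀ (by norm_num)
    have h2 : (1 : ℝ) ≤ L + 1 := by linarith [(Nat.cast_nonneg L : (0 : ℝ) ≤ L)]
    have h3 : (1 : ℝ) ≤ m := by exact_mod_cast hmpos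
    exact one_le_mul_of_one_le_of_one_le h1 (one_le_mul_of_one_le_of_one_le h2 h3)
  have hγ0 : 0 < γ := by rw [hγ]; positivity
  have hγ1 : γ ≤ 1 := by rw [hγ, div_le_one (by linarith)]; exact hLm
  have hYfin : ∀ i, volume (Y i) ≠ ∞ := fun i =>
    ((measure_mono (hYs i)).trans_lt (sbox_volume_ne_top _ _ _ _ _ hr.le).lt_top).ne
  have hUfin : volume (⋃ i, Y i) ≠ ∞ := by
    have := measure_biUnion_lt_top (μ := volume) (s := (Finset.univ : Finset ι)) (f := Y)
      (Finset.finite_toSet _) (fun i _ => (hYfin i).lt_top)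
    simpa using this.ne
  -- types
  let J : XX → Finset ι := fun z => Finset.univ.filter (fun i => z ∈ Y i)
  have hJ : ∀ z i, i ∈ J z ↔ z ∈ Y i := by intro z i; simp [J]
  have hJm : ∀ x : Finset ι, MeasurableSet (J ⁻¹' {x}) := by
    intro x
    have : J ⁻¹' {x} = ⋂ i, {z | z ∈ Y i ↔ i ∈ x} := by
      ext z
      simp only [mem_preimage, mem_singleton_iff, mem_iInter, mem_ofPred_eq, Finset.ext_iff, hJ]
    rw [this]
    apply MeasurableSet.iInter
    intro i
    by_cases h : i ∈ x
    · have e : {z | z ∈ Y i ↔ i ∈ x} = Y i := by ext z; simp [h]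
      rw [e]; exact hYm i
    · have e : {z | z ∈ Y i ↔ i ∈ x} = (Y i)ᶜ := by ext z; simp [h]
      rw [e]; exact (hYm i).compl
  have hJU : ∀ z, J z ≠ ∅ → z ∈ ⋃ i, Y i := by
    intro z hz
    obtain ⟨i, hi⟩ := Finset.nonempty_iff_ne_empty.2 hz
    exact mem_iUnion.2 ⟨i, (hJ z i).1 hi⟩
  let w : Finset ι → ℝ := fun x => volume.real (J ⁻¹' {x})
  have hw : ∀ x, 0 ≤ w x := fun x => measureReal_nonneg
  have hsum : ∀ (P : Finset ι → Prop) [DecidablePred P], ¬ P ∅ →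
      ∑ x, (if P x then w x else 0) = volume.real {z | P (J z)} := by
    intro P _ hP
    rw [← Finset.sum_filter]
    simp only [w]
    have hfin : ∀ x ∈ Finset.univ.filter P, volume (J ⁻¹' {x}) ≠ ∞ := by
      intro x hx
      rw [Finset.mem_filter] at hx
      refine ((measure_mono (t := ⋃ i, Y i) ?_).trans_lt hUfin.lt_top).ne
      intro z hz
      apply hJU
      rw [mem_preimage, mem_singleton_iff] at hz
      rw [hz]
      rintro rfl
      exact hP hx.2
    rw [sum_measureReal_preimage_singleton _ (fun y _ => hJm y) hfin]
    congr 1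
    ext z; simp
  have hPm : ∀ P : Finset ι → Prop, MeasurableSet {z | P (J z)} := by
    intro P
    have : {z | P (J z)} = ⋃ x ∈ Finset.univ.filter P, J ⁻¹' {x} := by
      ext z; simp
    rw [this]
    exact Finset.measurableSet_biUnion _ fun x _ => hJm x
  let d : ι → ι → ℝ := fun i j => ‖v i - v j‖
  let θ : ℕ → ℝ := fun k => 4 / K ^ k
  have hsym : ∀ i j, d i j = d j i := fun i j => norm_sub_rev _ _
  have htri : ∀ i j k, d i k ≤ d i j + d j k := fun i j k => norm_sub_le_norm_sub_add_norm_sub _ _ _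
  obtain ⟨k, hkL, N, hN, S, S2, hS2, hdeg, hcap, hbroad, hmassS, htot⟩ :=
    comb w hw (fun x => x) d θ L m
      (fun i j => by
        simp only [d, θ, pow_zero, div_one]
        exact (norm_sub_le _ _).trans (by linarith [hv i, hv j])) hsym htri hm (lam * r ^ 2)
      (fun i => by
        rw [hsum (fun x => i ∈ x) (by simp), ← hmass i]
        congr 1; ext z; simp [hJ]) γ hγ
  have hN1 : (0 : ℝ) < N := by exact_mod_cast hN
  have hS2e : S2 ∅ = ∅ := Finset.subset_empty.1 (hS2 ∅).1
  -- (a)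
  have ha : γ * M * (lam * r ^ 2) ≤ 4 * N * V := by
    have h1 : ∑ x, w x * (S2 x).card ≤ 2 * N * ∑ x, if (S2 x).Nonempty then w x else 0 := by
      rw [Finset.mul_sum]
      apply Finset.sum_le_sum
      intro x _
      split_ifs with h
      · have : ((S2 x).card : ℝ) ≤ 2 * N := by exact_mod_cast (hdeg x h).2
        nlinarith [hw x]
      · rw [Finset.not_nonempty_iff_eq_empty] at h
        simp [h]
    rw [hsum (fun x => (S2 x).Nonempty) (by simp [hS2e])] at h1
    have h2 : volume.real {z | (S2 (J z)).Nonempty} ≤ V := by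
      apply measureReal_mono _ hUfin
      rintro z ⟨i, hi⟩
      apply hJU
      exact Finset.ne_empty_of_mem ((hS2 _).1 hi)
    have : 2 * N * volume.real {z | (S2 (J z)).Nonempty} ≤ 2 * N * V := by gcongr
    linarith
  let Z : ι → Set XX := fun i => {z | i ∈ S2 (J z)}
  have hZm : ∀ i, MeasurableSet (Z i) := fun i => hPm (fun x => i ∈ S2 x)
  have hZY : ∀ i, Z i ⊆ Y i := fun i z hz => (hJ z i).1 ((hS2 _).1 hz)
  have hZsum : ∀ i, ∑ x, (if i ∈ S2 x then w x else 0) = volume.real (Z i) := fun i =>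
    hsum (fun x => i ∈ S2 x) (by simp [hS2e])
  -- size of S
  have hScard : γ * M / 2 ≤ S.card := by
    have h1 : ∑ x, w x * (S2 x).card = ∑ i ∈ S, volume.real (Z i) := by
      simp_rw [← hZsum]
      rw [Finset.sum_comm]
      apply Finset.sum_congr rfl
      intro x _
      rw [Finset.sum_ite_mem, Finset.inter_eq_right.2 (hS2 x).2]
      simp [mul_comm]
    have h2 : ∑ i ∈ S, volume.real (Z i) ≤ S.card * (lam * r ^ 2) := by
      rw [← nsmul_eq_mul]
      apply Finset.sum_le_card_nsmul
      intro i _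
      rw [← hmass i]
      exact measureReal_mono (hZY i) (hYfin i)
    have h3 : 0 < lam * r ^ 2 := by positivity
    rw [h1] at htot
    have := htot.trans h2
    apply le_of_mul_le_mul_right _ h3
    linarith
  have hSne : S.Nonempty := by
    rw [← Finset.card_pos]
    have : (0 : ℝ) < S.card := lt_of_lt_of_le (by positivity) hScard
    exact_mod_cast this
  rcases hkL.lt_or_eq with hk | hk
  swap
  · -- low multiplicity
    obtain ⟨x, hx⟩ : ∃ x, (S2 x).Nonempty := by
      by_contra! h
      have : ∑ x, w x * (S2 x).card = 0 := by
        apply Finset.sum_eq_zero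
        intro x _
        simp [h x]
      rw [this] at htot
      have : 0 < γ * (Fintype.card ι : ℝ) * (lam * r ^ 2) / 2 := by
        have : (0 : ℝ) < Fintype.card ι := by linarith
        positivity
      linarith
    obtain ⟨i, hi⟩ := hx
    have hθ : θ k ≤ r := by rw [hk]; exact hL
    have h1 := packing_ball (S2 x) v (r / 9) (2 * r) (v i) (by positivity)
      (fun a _ b _ hab => hsep a b hab) (by positivity)
      (fun j hj => by
        have := hcap x j hj i hi
        simp only [d] at this
        linarith)
    have h2 : 4 * (2 * r) / (r / 9) + 1 = 73 := by field_simp; norm_num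
    rw [h2] at h1
    have h3 : (N : ℝ) ≤ 4 * (S2 x).card := by exact_mod_cast (hdeg x ⟨i, hi⟩).1
    have h4 : γ * M * (lam * r ^ 2) ≤ 85264 * V := by
      refine ha.trans ?_
      gcongr
      linarith
    have h5 : (γ * M * (lam * r ^ 2)) ^ 4 ≤ (85264 * V) ^ 4 := by gcongr
    have h6 : γ ^ 11 * lam ^ 10 * (M * r ^ 2) ^ 3 * r ^ 2 ≤ (γ * M * (lam * r ^ 2)) ^ 4 := by
      have a1 : γ ^ 11 ≤ γ ^ 4 := pow_le_pow_of_le_one hγ0.le hγ1 (by norm_num)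
      have a2 : lam ^ 10 ≤ lam ^ 4 := pow_le_pow_of_le_one hl.le hl1 (by norm_num)
      calc _ ≤ γ ^ 4 * lam ^ 4 * (M * r ^ 2) ^ 3 * (M * r ^ 2) := by
            have a3 : r ^ 2 ≤ M * r ^ 2 := by nlinarith [sq_nonneg r]
            gcongr
        _ = _ := by ring
    have h7 : (1 : ℝ) ≤ (K * Λ) ^ 2 := by
      apply one_le_pow₀
      have : (1 : ℝ) ≤ Λ := by exact_mod_cast hΛ1
      nlinarith
    have h8 : 0 ≤ V ^ 4 := by positivity
    calc _ ≤ _ := h6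
      _ ≤ _ := h5
      _ ≤ (32 * 217 ^ 2 * 4 ^ 8 * 35840000000 ^ 2) * 1 * V ^ 4 := by
          rw [mul_pow]
          gcongr
          norm_num
      _ ≤ _ := by gcongr
  · -- hairbrush
    set t := θ k with ht
    have htr : r < t := hL' k hk
    have ht0 : 0 < t := hr.trans htr
    have hK0 : 0 < K := by linarith
    have hθ1 : θ (k + 1) = t / K := by
      simp only [ht, θ, pow_succ]; field_simp
    set κ := γ * lam / 4 with hκ
    have hκ0 : 0 < κ := by positivity
    have hκ1 : κ ≤ 1 := by rw [hκ]; nlinarith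
    have hZmass : ∀ i ∈ S, κ * r ^ 2 ≤ volume.real (Z i) := by
      intro i hi
      have := hmassS i hi
      rw [hZsum] at this
      rw [hκ]; linarith
    let H : ι → Finset ι := fun i =>
      Finset.univ.filter (fun j => ∃ z, i ∈ S2 (J z) ∧ j ∈ S2 (J z) ∧ t / K < d i j)
    have hH : ∀ i j, j ∈ H i ↔ ∃ z, i ∈ S2 (J z) ∧ j ∈ S2 (J z) ∧ t / K < d i j := by
      intro i j; simp [H]
    have hHcard : ∀ i ∈ S, κ * N * t ≤ 128 * r * K * (H i).card := by
      intro i hi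
      have h1 : κ * r ^ 2 * (N / 8) ≤ ∑ x, (if i ∈ S2 x then w x else 0) * (N / 8) := by
        rw [← Finset.sum_mul, hZsum]
        gcongr
        exact hZmass i hi
      have h2 : ∀ x, (if i ∈ S2 x then w x else 0) * ((N : ℝ) / 8) ≤
          ∑ j ∈ H i, if i ∈ S2 x ∧ j ∈ S2 x then w x else 0 := by
        intro x
        by_cases hx : i ∈ S2 x
        · simp only [hx, if_true, true_and]
          by_cases hw0 : w x = 0
          · simp [hw0]
          · have hne : (J ⁻¹' {x}).Nonempty := by
              rw [nonempty_iff_ne_empty]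
              intro h
              apply hw0
              simp [w, h]
            obtain ⟨z, hz⟩ := hne
            have hz' : J z = x := hz
            rw [Finset.sum_ite_mem, Finset.sum_const, nsmul_eq_mul, mul_comm]
            apply mul_le_mul_of_nonneg_right _ (hw x)
            have b1 := hbroad hk x i hx
            have b2 := (hdeg x ⟨i, hx⟩).1
            have b3 : (S2 x).filter (fun j => ¬ d i j ≤ θ (k + 1)) ⊆ H i ∩ S2 x := by
              intro j hj
              rw [Finset.mem_filter, hθ1, not_le] at hj
              rw [Finset.mem_inter, hH]
              exact ⟨⟨z, by rw [hz']; exact hx, by rw [hz']; exact hj.1, hj.2⟩, hj.1⟩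
            have b4 := Finset.card_le_card b3
            have b5 := Finset.card_filter_add_card_filter_not (s := S2 x) (fun j => d i j ≤ θ (k + 1))
            have b6 : N ≤ 8 * (H i ∩ S2 x).card := by omega
            have b7 : (N : ℝ) ≤ 8 * (H i ∩ S2 x).card := by exact_mod_cast b6
            linarith
        · simp [hx]
      have h3 : κ * r ^ 2 * (N / 8) ≤ ∑ j ∈ H i, volume.real {z | i ∈ S2 (J z) ∧ j ∈ S2 (J z)} := by
        refine h1.trans ((Finset.sum_le_sum fun x _ => h2 x).trans (le_of_eq ?_))
        rw [Finset.sum_comm]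
        apply Finset.sum_congr rfl
        intro j _
        exact hsum (fun x => i ∈ S2 x ∧ j ∈ S2 x) (by simp [hS2e])
      have h4 : ∑ j ∈ H i, volume.real {z | i ∈ S2 (J z) ∧ j ∈ S2 (J z)} ≤
          (H i).card * (16 * r ^ 3 * K / t) := by
        rw [← nsmul_eq_mul]
        apply Finset.sum_le_card_nsmul
        intro j hj
        obtain ⟨_, _, _, hd⟩ := (hH i j).1 hj
        have hd0 : 0 < d i j := lt_trans (by positivity) hd
        refine le_trans (measureReal_mono ?_ ?_)
          ((sbox_inter 0 0 1 1 (p i) (v i) (p j) (v j) r hr.le hd0).trans ?_)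
        · rintro z ⟨h1, h2⟩
          exact ⟨hYs i (hZY i h1), hYs j (hZY j h2)⟩
        · exact ((measure_mono inter_subset_left).trans_lt
            (sbox_volume_ne_top _ _ _ _ _ hr.le).lt_top).ne
        · calc 16 * r ^ 3 / ‖v i - v j‖ ≤ 16 * r ^ 3 / (t / K) := by
                gcongr
            _ = _ := by field_simp
      have h5 := h3.trans h4
      have hf : 0 < r ^ 2 / (8 * t) := by positivity
      apply le_of_mul_le_mul_left _ hf
      calc _ = κ * r ^ 2 * (N / 8) := by field_simp
        _ ≤ _ := h5
        _ = _ := by field_simp; ring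
    let EE : ι → Set XX := fun i => ⋃ j ∈ H i, Z j
    have hEm : ∀ i, MeasurableSet (EE i) := fun i => Finset.measurableSet_biUnion _ fun j _ => hZm j
    have hEU : ∀ i, EE i ⊆ ⋃ i, Y i := fun i => iUnion₂_subset fun j _ =>
      (hZY j).trans (subset_iUnion Y j)
    have hhair : ∀ i ∈ S, κ ^ 4 * N * t * r ≤ 35840000000 * (K * Λ) * volume.real (EE i) := by
      intro i hi
      have hex : ∀ j ∈ H i, ∃ τ : ℝ, ‖(p j - p i) + τ • (v j - v i)‖ ≤ 2 * r := by
        intro j hj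
        obtain ⟨z, h1, h2, _⟩ := (hH i j).1 hj
        refine ⟨z.1, ?_⟩
        have b1 := (hYs i (hZY i h1)).2
        have b2 := (hYs j (hZY j h2)).2
        have : (p j - p i) + z.1 • (v j - v i) =
            (z.2 - p i - z.1 • v i) - (z.2 - p j - z.1 • v j) := by
          ext c; simp; ring
        rw [this]
        exact (norm_sub_le _ _).trans (by linarith)
      choose! τ hτ using hex
      have h1 := hairbrush (H i) p v (p i) (v i) Z τ r κ Λ hr hκ0 hκ1 hΛ hΛ1 (fun i _ => hv i)
        (fun a _ b _ hab => hsep a b hab) (fun j _ => hZm j) (fun j _ => (hZY j).trans (hYs j))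
        (fun j hj => by
          obtain ⟨z, _, h2, _⟩ := (hH i j).1 hj
          exact hZmass j ((hS2 _).2 h2)) hτ
      have h2 := hHcard i hi
      calc κ ^ 4 * N * t * r = κ ^ 3 * r * (κ * N * t) := by ring
        _ ≤ κ ^ 3 * r * (128 * r * K * (H i).card) := by gcongr
        _ = 128 * K * ((H i).card * κ ^ 3 * r ^ 2) := by ring
        _ ≤ 128 * K * (280000000 * Λ * volume.real (EE i)) := by gcongr
        _ = _ := by ring
    obtain ⟨D, hDS, hDsep, hDcov⟩ := exists_separated S d (6 * t) hsym
      (fun i => by simp only [d, sub_self, norm_zero]; positivity)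
    have hdisj : (D : Set ι).PairwiseDisjoint EE := by
      intro i hi i' hi' hne
      rw [Function.onFun, Set.disjoint_left]
      intro z hz hz'
      simp only [EE, mem_iUnion] at hz hz'
      obtain ⟨j, hj, hzj⟩ := hz
      obtain ⟨j', hj', hzj'⟩ := hz'
      obtain ⟨y, a1, a2, _⟩ := (hH i j).1 hj
      obtain ⟨y', b1, b2, _⟩ := (hH i' j').1 hj'
      have c1 := hcap _ i a1 j a2
      have c2 := hcap _ j' b2 i' b1
      have c3 := hcap _ j hzj j' hzj'
      have := hDsep i hi i' hi' hne
      have e1 := htri i j i'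
      have e2 := htri j j' i'
      linarith
    have hq1 : D.card * (κ ^ 4 * N * t * r) ≤ 35840000000 * (K * Λ) * V := by
      have h1 : ∑ i ∈ D, volume.real (EE i) ≤ V := by
        rw [← measureReal_biUnion_finset hdisj (fun i _ => hEm i)
          (fun i _ => ((measure_mono (hEU i)).trans_lt hUfin.lt_top).ne)]
        exact measureReal_mono (iUnion₂_subset fun i _ => hEU i) hUfin
      calc D.card * (κ ^ 4 * N * t * r) = ∑ i ∈ D, (κ ^ 4 * N * t * r) := by
            rw [Finset.sum_const, nsmul_eq_mul]
        _ ≤ ∑ i ∈ D, 35840000000 * (K * Λ) * volume.real (EE i) :=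
            Finset.sum_le_sum fun i hi => hhair i (hDS hi)
        _ = 35840000000 * (K * Λ) * ∑ i ∈ D, volume.real (EE i) := by rw [Finset.mul_sum]
        _ ≤ _ := by gcongr
    have hq2 : γ * M * r ^ 2 ≤ D.card * (2 * 217 ^ 2 * t ^ 2) := by
      have h1 : (S.card : ℝ) ≤ D.card * (217 * t / r) ^ 2 := by
        have hsub : S ⊆ D.biUnion (fun j => S.filter (fun i => d i j ≤ 6 * t)) := by
          intro i hi
          obtain ⟨j, hj, hij⟩ := hDcov i hi
          exact Finset.mem_biUnion.2 ⟨j, hj, Finset.mem_filter.2 ⟨hi, hij⟩⟩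
        have h2 : (S.card : ℝ) ≤ ∑ j ∈ D, ((S.filter (fun i => d i j ≤ 6 * t)).card : ℝ) := by
          exact_mod_cast (Finset.card_le_card hsub).trans Finset.card_biUnion_le
        refine h2.trans ?_
        rw [← nsmul_eq_mul]
        apply Finset.sum_le_card_nsmul
        intro j _
        refine (packing_ball _ v (r / 9) (6 * t) (v j) (by positivity)
          (fun a _ b _ hab => hsep a b hab) (by positivity)
          (fun i hi => (Finset.mem_filter.1 hi).2)).trans ?_
        gcongr
        rw [div_div_eq_mul_div, div_add_one hr.ne']
        gcongr; linarith
      have h2 := hScard.trans h1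
      rw [div_pow, ← mul_div_assoc, le_div_iff₀ (by positivity)] at h2
      linarith
    have hDne : 1 ≤ (D.card : ℝ) := by
      obtain ⟨i, hi⟩ := hSne
      obtain ⟨j, hj, _⟩ := hDcov i hi
      exact_mod_cast Finset.card_pos.2 ⟨j, hj⟩
    set q : ℝ := (D.card : ℝ) with hq
    set B : ℝ := 35840000000 with hB
    have hΛ0 : (1 : ℝ) ≤ Λ := by exact_mod_cast hΛ1
    -- product
    have e1 : γ * lam * (M * r ^ 2) * κ ^ 4 * (q * t) * r ≤ 4 * B * (K * Λ) * V ^ 2 := by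
      have h1 : (γ * M * (lam * r ^ 2)) * (q * (κ ^ 4 * N * t * r)) ≤
          (4 * N * V) * (B * (K * Λ) * V) := by
        apply mul_le_mul ha hq1 (by positivity) (by positivity)
      apply le_of_mul_le_mul_left _ hN1
      calc _ = (γ * M * (lam * r ^ 2)) * (q * (κ ^ 4 * N * t * r)) := by ring
        _ ≤ _ := h1
        _ = _ := by ring
    have e2 : (γ * lam * (M * r ^ 2) * κ ^ 4 * (q * t) * r) ^ 2 ≤ (4 * B * (K * Λ) * V ^ 2) ^ 2 := by
      gcongr
    have e3 : γ * M * r ^ 2 ≤ 2 * 217 ^ 2 * (q * t) ^ 2 := by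
      have : q * t ^ 2 ≤ (q * t) ^ 2 := by
        rw [mul_pow]
        gcongr
        nlinarith
      linarith
    calc γ ^ 11 * lam ^ 10 * (M * r ^ 2) ^ 3 * r ^ 2
        = 4 ^ 8 * (γ * lam * (M * r ^ 2) * κ ^ 4 * r) ^ 2 * (γ * M * r ^ 2) := by
          rw [hκ]; ring
      _ ≤ 4 ^ 8 * (γ * lam * (M * r ^ 2) * κ ^ 4 * r) ^ 2 * (2 * 217 ^ 2 * (q * t) ^ 2) := by
          gcongr
      _ = 4 ^ 8 * 2 * 217 ^ 2 * (γ * lam * (M * r ^ 2) * κ ^ 4 * (q * t) * r) ^ 2 := by ring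
      _ ≤ 4 ^ 8 * 2 * 217 ^ 2 * (4 * B * (K * Λ) * V ^ 2) ^ 2 := by gcongr
      _ = _ := by ring

lemma trim_set (p v : WW) (r a : ℝ) (Y : Set XX) (hr : 0 ≤ r) (hYm : MeasurableSet Y)
    (hYs : Y ⊆ sbox 0 1 p v r) (ha0 : 0 ≤ a) (ha : a ≤ volume.real Y) :
    ∃ Y' ⊆ Y, MeasurableSet Y' ∧ volume.real Y' = a := by
  have hYfin : volume Y ≠ ∞ :=
    ((measure_mono hYs).trans_lt (sbox_volume_ne_top _ _ _ _ _ hr).lt_top).ne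
  let f : ℝ → ℝ := fun s => volume.real (Y ∩ {z | z.1 ≤ s})
  have hmono : Monotone f := by
    intro s t hst
    apply measureReal_mono
    · rintro z ⟨h1, h2⟩
      exact ⟨h1, le_trans h2 hst⟩
    · exact ((measure_mono inter_subset_left).trans_lt hYfin.lt_top).ne
  have hlip : LipschitzWith (Real.toNNReal ((2 * r) ^ 2)) f := by
    apply LipschitzWith.of_le_add_mul
    intro s t
    rw [Real.coe_toNNReal _ (by positivity)]
    rcases le_total s t with h | h
    · have := hmono h
      have h2 : 0 ≤ (2 * r) ^ 2 * dist s t := by positivity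
      linarith
    · have hsub : Y ∩ {z | z.1 ≤ s} ⊆ (Y ∩ {z | z.1 ≤ t}) ∪ sbox ((s + t) / 2) ((s - t) / 2) p v r := by
        rintro z ⟨h1, h2⟩
        by_cases h3 : z.1 ≤ t
        · exact Or.inl ⟨h1, h3⟩
        · refine Or.inr ⟨?_, (hYs h1).2⟩
          have h2' : z.1 ≤ s := h2
          rw [abs_le]; constructor <;> linarith
      have h4 : f s ≤ volume.real ((Y ∩ {z | z.1 ≤ t}) ∪ sbox ((s + t) / 2) ((s - t) / 2) p v r) := by
        refine measureReal_mono hsub ?_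
        exact (measure_union_lt_top ((measure_mono inter_subset_left).trans_lt hYfin.lt_top)
          (sbox_volume_ne_top _ _ _ _ _ hr).lt_top).ne
      refine h4.trans ((measureReal_union_le _ _).trans ?_)
      rw [sbox_real _ _ _ _ _ (by linarith) hr, Real.dist_eq, abs_of_nonneg (by linarith)]
      simp only [f]
      linarith
  have h0 : f (-2) = 0 := by
    have : Y ∩ {z | z.1 ≤ -2} = ∅ := by
      ext z
      simp only [mem_inter_iff, mem_ofPred_eq, mem_empty_iff_false, iff_false, not_and, not_le]
      intro h
      have := (hYs h).1
      rw [abs_le] at this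
      linarith
    simp [f, this]
  have h1 : f 1 = volume.real Y := by
    have : Y ∩ {z | z.1 ≤ 1} = Y := by
      ext z
      simp only [mem_inter_iff, mem_ofPred_eq, and_iff_left_iff_imp]
      intro h
      have := (hYs h).1
      rw [abs_le] at this
      linarith
    simp [f, this]
  obtain ⟨s, _, hs⟩ := intermediate_value_Icc (by norm_num : (-2 : ℝ) ≤ 1) hlip.continuous.continuousOn
    (show a ∈ Icc (f (-2)) (f 1) from ⟨by rw [h0]; exact ha0, by rw [h1]; exact ha⟩)
  exact ⟨_, inter_subset_left, hYm.inter (measurableSet_le measurable_fst measurable_const), hs⟩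

lemma poly_bound (ε : ℝ) (hε : 0 < ε) : ∃ C > (0 : ℝ), ∀ Λ : ℕ,
    (2 * (Λ : ℝ) + 14) ^ 24 ≤ C * (2 : ℝ) ^ (ε * (Λ + 1)) := by
  set ρ : ℝ := 2 ^ (-ε) with hρ
  have hρ0 : 0 < ρ := by positivity
  have hρ1 : ρ < 1 := Real.rpow_lt_one_of_one_lt_of_neg (by norm_num) (by linarith)
  obtain ⟨B, hB⟩ := (tendsto_pow_const_mul_const_pow_of_abs_lt_one 24
    (by rwa [abs_of_pos hρ0] : |ρ| < 1)).bddAbove_range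
  refine ⟨14 ^ 24 * (max B 1), by positivity, ?_⟩
  intro Λ
  have h1 : ((Λ + 1 : ℕ) : ℝ) ^ 24 * ρ ^ (Λ + 1) ≤ max B 1 :=
    (hB ⟨Λ + 1, rfl⟩).trans (le_max_left _ _)
  have h2 : ρ ^ (Λ + 1) * (2 : ℝ) ^ (ε * (Λ + 1)) = 1 := by
    rw [hρ, ← Real.rpow_natCast, ← Real.rpow_mul (by norm_num), ← Real.rpow_add (by norm_num)]
    push_cast
    ring_nf
    simp
  calc (2 * (Λ : ℝ) + 14) ^ 24 ≤ (14 * (Λ + 1)) ^ 24 := by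
        gcongr
        linarith [(Nat.cast_nonneg Λ : (0 : ℝ) ≤ Λ)]
    _ = 14 ^ 24 * (((Λ + 1 : ℕ) : ℝ) ^ 24 * (ρ ^ (Λ + 1) * (2 : ℝ) ^ (ε * (Λ + 1)))) := by
        rw [h2]; push_cast; ring
    _ = 14 ^ 24 * (((Λ + 1 : ℕ) : ℝ) ^ 24 * ρ ^ (Λ + 1)) * (2 : ℝ) ^ (ε * (Λ + 1)) := by ring
    _ ≤ _ := by gcongr

lemma params (ε : ℝ) (hε : 0 < ε) : ∃ C > (0 : ℝ), ∃ K : ℝ, 1 ≤ K ∧ ∀ r : ℝ, 0 < r → r ≤ 1 →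
    ∃ L m Λ : ℕ, 4 / K ^ L ≤ r ∧ (∀ k < L, r < 4 / K ^ k) ∧ (4 * 2 / (r / 9) + 1) ^ 2 < (2 : ℝ) ^ m ∧
      1 / r ≤ 2 ^ Λ ∧ 1 ≤ Λ ∧ 1 ≤ m ∧
      (32 ^ L * (((L : ℝ) + 1) * m)) ^ 11 * (K * Λ) ^ 2 ≤ C * r ^ (-ε) := by
  obtain ⟨n, hn⟩ := exists_nat_ge (110 / ε + 1)
  have hn1 : (1 : ℝ) ≤ n := by have : 0 < 110 / ε := by positivity
                               linarith
  have hn1' : 1 ≤ n := by exact_mod_cast hn1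
  have hn55 : 55 / (n : ℝ) ≤ ε / 2 := by
    rw [div_le_iff₀ (by linarith)]
    have : 110 / ε ≤ n := by linarith
    rw [div_le_iff₀ hε] at this
    linarith
  obtain ⟨C, hC, hpoly⟩ := poly_bound (ε / 2) (by positivity)
  refine ⟨(2 : ℝ) ^ 55 * 4 ^ n * C * 8 ^ ε, by positivity, 2 ^ n, one_le_pow₀ (by norm_num), ?_⟩
  intro r hr hr1
  have hr1' : 1 ≤ 1 / r := by rw [le_div_iff₀ hr]; linarith
  -- Λ
  obtain ⟨q, hq1, hq2⟩ := exists_nat_pow_near hr1' (by norm_num : (1 : ℝ) < 2)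
  set Λ := q + 1 with hΛ
  have hΛr : (2 : ℝ) ^ Λ ≤ 2 / r := by
    rw [hΛ, pow_succ]
    calc (2 : ℝ) ^ q * 2 ≤ 1 / r * 2 := by gcongr
      _ = _ := by ring
  -- L
  have hexL : ∃ L : ℕ, 4 / ((2 : ℝ) ^ n) ^ L ≤ r := by
    obtain ⟨L, hL⟩ := pow_unbounded_of_one_lt (4 / r) (one_lt_pow₀ (by norm_num : (1 : ℝ) < 2) (by omega : n ≠ 0))
    refine ⟨L, ?_⟩
    rw [div_le_iff₀ (by positivity)]
    rw [div_lt_iff₀ hr] at hL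
    linarith
  classical
  let L := Nat.find hexL
  have hL := Nat.find_spec hexL
  have hLm : ∀ k < L, r < 4 / ((2 : ℝ) ^ n) ^ k := fun k hk => not_le.1 (Nat.find_min hexL hk)
  have hL0 : L ≠ 0 := by
    intro h
    have : 4 / ((2 : ℝ) ^ n) ^ L ≤ r := hL
    rw [h] at this
    norm_num at this
    linarith
  obtain ⟨l, hl⟩ := Nat.exists_eq_succ_of_ne_zero hL0
  have hnl : n * l ≤ Λ + 1 := by
    have h1 := hLm l (by omega)
    rw [lt_div_iff₀ (by positivity), ← pow_mul] at h1
    have h2 : (2 : ℝ) ^ (n * l) < 2 ^ (Λ + 2) := by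
      have : (2 : ℝ) ^ (n * l) < 4 / r := by rw [lt_div_iff₀ hr]; linarith
      refine this.trans_le ?_
      rw [pow_add]
      calc 4 / r = 1 / r * 2 ^ 2 := by ring
        _ ≤ _ := by gcongr
    have := (pow_lt_pow_iff_right₀ (by norm_num : (1 : ℝ) < 2)).1 h2
    omega
  have hlΛ : l ≤ Λ + 1 := le_trans (Nat.le_mul_of_pos_left l (by omega)) hnl
  refine ⟨L, 2 * Λ + 14, Λ, hL, hLm, ?_, hq2.le, by omega, by omega, ?_⟩
  · have h1 : 4 * 2 / (r / 9) + 1 < 2 ^ (Λ + 7) := by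
      calc 4 * 2 / (r / 9) + 1 ≤ 72 * (1 / r) + 1 / r := by
            have : 4 * 2 / (r / 9) = 72 * (1 / r) := by field_simp; norm_num
            rw [this]; linarith
        _ < 128 * (1 / r) := by linarith
        _ ≤ 128 * 2 ^ Λ := by gcongr
        _ = _ := by rw [pow_add]; norm_num; ring
    calc (4 * 2 / (r / 9) + 1) ^ 2 < (2 ^ (Λ + 7)) ^ 2 := by gcongr
      _ = _ := by rw [← pow_mul]; congr 1; ring
  · have hΛ0 : (0 : ℝ) ≤ Λ := Nat.cast_nonneg _
    have hlΛ' : (l : ℝ) ≤ Λ + 1 := by exact_mod_cast hlΛ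
    have hLl : (L : ℝ) = l + 1 := by rw [hl]; push_cast; ring
    have h1 : (32 ^ L * (((L : ℝ) + 1) * ((2 * Λ + 14 : ℕ) : ℝ))) ^ 11 * (2 ^ n * Λ) ^ 2 ≤
        (2 : ℝ) ^ (55 * L) * 4 ^ n * (2 * (Λ : ℝ) + 14) ^ 24 := by
      have e1 : (32 : ℝ) ^ L = 2 ^ (5 * L) := by rw [pow_mul]; norm_num
      have e2 : (4 : ℝ) ^ n = (2 ^ n) ^ 2 := by rw [← pow_mul, mul_comm n 2, pow_mul]; norm_num
      have e3 : (2 : ℝ) ^ (55 * L) = (2 ^ (5 * L)) ^ 11 := by rw [← pow_mul]; congr 1; ring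
      rw [e1, e2, e3]
      push_cast
      have f1 : (L : ℝ) + 1 ≤ 2 * (Λ : ℝ) + 14 := by linarith
      have f2 : (Λ : ℝ) ≤ 2 * (Λ : ℝ) + 14 := by linarith
      calc _ ≤ (2 ^ (5 * L) * ((2 * (Λ : ℝ) + 14) * (2 * Λ + 14))) ^ 11 * (2 ^ n * (2 * Λ + 14)) ^ 2 :=
            mul_le_mul (pow_le_pow_left₀ (by positivity) (mul_le_mul_of_nonneg_left
              (mul_le_mul_of_nonneg_right f1 (by positivity)) (by positivity)) _)
              (pow_le_pow_left₀ (by positivity) (mul_le_mul_of_nonneg_left f2 (by positivity)) _)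
              (by positivity) (by positivity)
        _ = _ := by ring
    have h2 : (2 : ℝ) ^ (55 * L) ≤ 2 ^ 55 * (2 : ℝ) ^ (ε / 2 * (Λ + 1)) := by
      rw [hl, Nat.mul_succ, pow_add, mul_comm]
      gcongr
      rw [← Real.rpow_natCast]
      apply Real.rpow_le_rpow_of_exponent_le (by norm_num)
      push_cast
      have hnl' : (n : ℝ) * l ≤ Λ + 1 := by exact_mod_cast hnl
      calc (55 : ℝ) * l = 55 / n * (n * l) := by field_simp
        _ ≤ ε / 2 * (Λ + 1) := by gcongr
    have h3 := hpoly Λ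
    have h4 : (2 : ℝ) ^ (ε / 2 * ((Λ : ℝ) + 1)) * (2 : ℝ) ^ (ε / 2 * ((Λ : ℝ) + 1)) ≤ 8 ^ ε * r ^ (-ε) := by
      rw [← Real.rpow_add (by norm_num)]
      have : ε / 2 * ((Λ : ℝ) + 1) + ε / 2 * (Λ + 1) = ((Λ + 1 : ℕ) : ℝ) * ε := by push_cast; ring
      rw [this, Real.rpow_mul (by norm_num), Real.rpow_natCast, Real.rpow_neg hr.le, ← Real.inv_rpow hr.le,
        ← Real.mul_rpow (by norm_num) (by positivity)]
      apply Real.rpow_le_rpow (by positivity) _ hε.le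
      rw [pow_succ]
      have : 0 < r⁻¹ := by positivity
      calc (2 : ℝ) ^ Λ * 2 ≤ 2 / r * 2 := by gcongr
        _ = 4 * r⁻¹ := by ring
        _ ≤ _ := by linarith
    calc _ ≤ _ := h1
      _ ≤ (2 ^ 55 * (2 : ℝ) ^ (ε / 2 * (Λ + 1))) * 4 ^ n * (C * (2 : ℝ) ^ (ε / 2 * (Λ + 1))) := by gcongr
      _ = 2 ^ 55 * 4 ^ n * C * ((2 : ℝ) ^ (ε / 2 * ((Λ : ℝ) + 1)) * (2 : ℝ) ^ (ε / 2 * ((Λ : ℝ) + 1))) := by ring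
      _ ≤ 2 ^ 55 * 4 ^ n * C * (8 ^ ε * r ^ (-ε)) := by gcongr
      _ = _ := by ring

lemma core_eps (ε : ℝ) (hε : 0 < ε) : ∃ C > (0 : ℝ), ∀ (ι : Type) [Fintype ι] [Nonempty ι]
    (p v : ι → WW) (Y : ι → Set XX) (r lam : ℝ) (_ : 0 < r) (_ : r ≤ 1) (_ : 0 < lam) (_ : lam ≤ 1)
    (_ : ∀ i, ‖v i‖ ≤ 2) (_ : ∀ i j, i ≠ j → r / 9 ≤ ‖v i - v j‖)
    (_ : ∀ i, MeasurableSet (Y i)) (_ : ∀ i, Y i ⊆ sbox 0 1 (p i) (v i) r)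
    (_ : ∀ i, lam * r ^ 2 ≤ volume.real (Y i)),
    lam ^ 10 * (Fintype.card ι * r ^ 2) ^ 3 * r ^ 2 ≤ C * r ^ (-ε) * (volume.real (⋃ i, Y i)) ^ 4 := by
  obtain ⟨C, hC, K, hK, H⟩ := params ε hε
  refine ⟨(32 * 217 ^ 2 * 4 ^ 8 * 35840000000 ^ 2) * C, by positivity, ?_⟩
  intro ι _ _ p v Y r lam hr hr1 hl hl1 hv hsep hYm hYs hmass
  obtain ⟨L, m, Λ, h1, h2, h3, h4, h5, h6, h7⟩ := H r hr hr1
  have hex : ∀ i, ∃ Y' ⊆ Y i, MeasurableSet Y' ∧ volume.real Y' = lam * r ^ 2 := fun i =>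
    trim_set (p i) (v i) r _ (Y i) hr.le (hYm i) (hYs i) (by positivity) (hmass i)
  choose Y' hs hm' hv' using hex
  have hcard : Fintype.card ι < 2 ^ m := by
    have := packing_ball Finset.univ v (r / 9) 2 0 (by positivity) (fun a _ b _ hab => hsep a b hab)
      (by norm_num) (fun i _ => by simpa using hv i)
    have := this.trans_lt h3
    rw [Finset.card_univ] at this
    exact_mod_cast this
  have hYfin : ∀ i, volume (Y i) ≠ ∞ := fun i =>
    ((measure_mono (hYs i)).trans_lt (sbox_volume_ne_top _ _ _ _ _ hr.le).lt_top).ne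
  have hUfin : volume (⋃ i, Y i) ≠ ∞ := by
    have := measure_biUnion_lt_top (μ := volume) (s := (Finset.univ : Finset ι)) (f := Y)
      (Finset.finite_toSet _) (fun i _ => (hYfin i).lt_top)
    simpa using this.ne
  have key := core_exact p v Y' r lam K _ L m Λ hr hr1 hl hl1 hK h1 h2 hcard h4 h5 rfl hv hsep hm'
    (fun i => (hs i).trans (hYs i)) hv'
  have hV : volume.real (⋃ i, Y' i) ≤ volume.real (⋃ i, Y i) :=
    measureReal_mono (iUnion_mono hs) hUfin
  set G : ℝ := 32 ^ L * (((L : ℝ) + 1) * m) with hG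
  have hm0 : (0 : ℝ) < m := by exact_mod_cast h6
  have hG0 : 0 < G := by positivity
  set X := lam ^ 10 * (Fintype.card ι * r ^ 2) ^ 3 * r ^ 2 with hX
  set V := volume.real (⋃ i, Y i) with hVd
  set V' := volume.real (⋃ i, Y' i) with hVd'
  have hV'0 : 0 ≤ V' := measureReal_nonneg
  set A : ℝ := 32 * 217 ^ 2 * 4 ^ 8 * 35840000000 ^ 2 with hA
  have hA0 : 0 < A := by positivity
  have key2 : X ≤ A * (G ^ 11 * (K * Λ) ^ 2) * V' ^ 4 := by
    have : X = G ^ 11 * ((1 / G) ^ 11 * lam ^ 10 * (Fintype.card ι * r ^ 2) ^ 3 * r ^ 2) := by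
      rw [hX]; field_simp
    rw [this]
    calc _ ≤ G ^ 11 * (A * (K * Λ) ^ 2 * V' ^ 4) := by gcongr
      _ = _ := by ring
  calc X ≤ _ := key2
    _ ≤ A * (C * r ^ (-ε)) * V ^ 4 := by gcongr
    _ = _ := by ring

abbrev E3 := EuclideanSpace ℝ (Fin 3)

def eqv (c : Fin 3) : E3 ≃ᵐ XX :=
  (MeasurableEquiv.toLp 2 (Fin 3 → ℝ)).symm.trans (MeasurableEquiv.piFinSuccAbove (fun _ => ℝ) c)

lemma eqv_fst (c : Fin 3) (x : E3) : (eqv c x).1 = x c := rfl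

lemma eqv_snd (c : Fin 3) (x : E3) (j : Fin 2) : (eqv c x).2 j = x (c.succAbove j) := rfl

lemma eqv_mp (c : Fin 3) : MeasurePreserving (eqv c) volume volume :=
  (EuclideanSpace.volume_preserving_symm_measurableEquiv_toLp (Fin 3)).trans
    (volume_preserving_piFinSuccAbove (fun _ => ℝ) c)

def vv (c : Fin 3) (ξ : E3) : WW := fun j => ξ (c.succAbove j) / ξ c

def pp (c : Fin 3) (ξ a : E3) : WW := fun j => a (c.succAbove j) - a c * vv c ξ j

lemma E3_abs_le (x : E3) (k : Fin 3) : |x k| ≤ ‖x‖ := by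
  have := PiLp.norm_apply_le x k
  simpa using this

lemma E3_norm_sq (c : Fin 3) (x : E3) :
    ‖x‖ ^ 2 = (x c) ^ 2 + ((x (c.succAbove 0)) ^ 2 + (x (c.succAbove 1)) ^ 2) := by
  rw [EuclideanSpace.real_norm_sq_eq, Fin.sum_univ_succAbove _ c, Fin.sum_univ_two]

lemma vv_mul (c : Fin 3) (ξ : E3) (h : 1 / 2 ≤ |ξ c|) (j : Fin 2) :
    ξ c * vv c ξ j = ξ (c.succAbove j) := by
  have : ξ c ≠ 0 := by intro h0; rw [h0] at h; norm_num at h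
  simp only [vv]; field_simp

lemma vv_norm (c : Fin 3) (ξ : E3) (h1 : ‖ξ‖ = 1) (h : 1 / 2 ≤ |ξ c|) : ‖vv c ξ‖ ≤ 2 := by
  rw [pi_norm_le_iff_of_nonneg (by norm_num)]
  intro j
  rw [Real.norm_eq_abs, vv, abs_div, div_le_iff₀ (by linarith)]
  have := E3_abs_le ξ (c.succAbove j)
  linarith

lemma tube_sub (c : Fin 3) (ξ a x : E3) (δ : ℝ) (h1 : ‖ξ‖ = 1) (h : 1 / 2 ≤ |ξ c|) (hδ : 0 < δ)
    (hx : x ∈ tube 3 δ ξ a) (hb : ‖x‖ ≤ 1) : eqv c x ∈ sbox 0 1 (pp c ξ a) (vv c ξ) (3 * δ) := by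
  obtain ⟨-, h3⟩ := hx
  refine ⟨by rw [sub_zero, eqv_fst]; exact (E3_abs_le x c).trans hb, ?_⟩
  set s := ⟪x - a, ξ⟫ with hs
  have hw : ∀ k, |(x k - a k) - s * ξ k| ≤ δ := by
    intro k
    have := (E3_abs_le _ k).trans h3
    simpa using this
  rw [pi_norm_le_iff_of_nonneg (by positivity)]
  intro j
  have e : ((eqv c x).2 - pp c ξ a - (eqv c x).1 • vv c ξ) j =
      ((x (c.succAbove j) - a (c.succAbove j)) - s * ξ (c.succAbove j)) -
        ((x c - a c) - s * ξ c) * vv c ξ j := by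
    simp only [Pi.sub_apply, Pi.smul_apply, smul_eq_mul, eqv_snd, eqv_fst, pp]
    rw [← vv_mul c ξ h j]; ring
  rw [e, Real.norm_eq_abs]
  refine (abs_sub _ _).trans ?_
  rw [abs_mul]
  have b1 := hw (c.succAbove j)
  have b2 := hw c
  have b3 := (WW_abs_le _ j).trans (vv_norm c ξ h1 h)
  have := mul_le_mul b2 b3 (abs_nonneg _) hδ.le
  linarith

lemma tube_sup (c : Fin 3) (ξ a x : E3) (δ : ℝ) (h1 : ‖ξ‖ = 1) (h : 1 / 2 ≤ |ξ c|) (hδ : 0 < δ)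
    (hδ1 : δ ≤ 1 / 2) (hx : eqv c x ∈ sbox (a c) (1 / 16) (pp c ξ a) (vv c ξ) (δ / 4)) :
    x ∈ tube 3 δ ξ a := by
  obtain ⟨h2, h3⟩ := hx
  rw [eqv_fst] at h2 h3
  have hne : ξ c ≠ 0 := by intro h0; rw [h0] at h; norm_num at h
  set σ := (x c - a c) / ξ c with hσ
  have hσ1 : |σ| ≤ 1 / 8 := by
    rw [hσ, abs_div, div_le_iff₀ (by linarith)]; linarith
  set W : E3 := x - a - σ • ξ with hW
  have hWc : W c = 0 := by
    simp only [hW, PiLp.sub_apply, PiLp.smul_apply, smul_eq_mul, hσ]; field_simp; ring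
  have hWj : ∀ j, |W (c.succAbove j)| ≤ δ / 4 := by
    intro j
    have := (WW_abs_le _ j).trans h3
    have e : ((eqv c x).2 - pp c ξ a - x c • vv c ξ) j = W (c.succAbove j) := by
      simp only [Pi.sub_apply, Pi.smul_apply, smul_eq_mul, eqv_snd, pp, hW, PiLp.sub_apply,
        PiLp.smul_apply, hσ, vv]
      field_simp; ring
    rwa [e] at this
  have hWn : ‖W‖ ≤ δ / 2 := by
    apply abs_le_of_sq_le_sq' _ (by positivity) |>.2
    rw [E3_norm_sq c, hWc]
    have a0 := sq_le_sq' (abs_le.1 (hWj 0)).1 (abs_le.1 (hWj 0)).2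
    have a1 := sq_le_sq' (abs_le.1 (hWj 1)).1 (abs_le.1 (hWj 1)).2
    nlinarith
  have hi : |⟪W, ξ⟫| ≤ δ / 2 := by
    have := abs_real_inner_le_norm W ξ
    rw [h1, mul_one] at this
    linarith
  have hxa : x - a = W + σ • ξ := by rw [hW]; abel
  have hin : ⟪x - a, ξ⟫ = ⟪W, ξ⟫ + σ := by
    rw [hxa, inner_add_left, real_inner_smul_left, real_inner_self_eq_norm_sq, h1]; ring
  refine ⟨?_, ?_⟩
  · rw [hin]
    refine (abs_add_le _ _).trans ?_
    linarith
  · rw [hin, hxa]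
    have : W + σ • ξ - (⟪W, ξ⟫ + σ) • ξ = W - ⟪W, ξ⟫ • ξ := by rw [add_smul]; abel
    rw [this]
    refine (norm_sub_le _ _).trans ?_
    rw [norm_smul, h1, Real.norm_eq_abs]
    linarith

lemma tube_vol (c : Fin 3) (ξ a : E3) (δ : ℝ) (h1 : ‖ξ‖ = 1) (h : 1 / 2 ≤ |ξ c|) (hδ : 0 < δ)
    (hδ1 : δ ≤ 1 / 2) : ENNReal.ofReal (δ ^ 2 / 32) ≤ volume (tube 3 δ ξ a) := by
  calc ENNReal.ofReal (δ ^ 2 / 32) =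
        volume (sbox (a c) (1 / 16) (pp c ξ a) (vv c ξ) (δ / 4)) := by
        rw [sbox_volume _ _ _ _ _ (by positivity), ← ENNReal.ofReal_mul (by norm_num)]
        congr 1; ring
    _ = volume (eqv c ⁻¹' sbox (a c) (1 / 16) (pp c ξ a) (vv c ξ) (δ / 4)) :=
        ((eqv_mp c).measure_preimage (sbox_meas _ _ _ _ _).nullMeasurableSet).symm
    _ ≤ _ := measure_mono fun x hx => tube_sup c ξ a x δ h1 h hδ hδ1 hx

lemma sep_alg (α β a1 a2 b1 b2 : ℝ) (hα : α ^ 2 * (1 + a1 ^ 2 + a2 ^ 2) = 1)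
    (hβ : β ^ 2 * (1 + b1 ^ 2 + b2 ^ 2) = 1) (h : 0 < α * β) :
    (α - β) ^ 2 + ((α * a1 - β * b1) ^ 2 + (α * a2 - β * b2) ^ 2) ≤
      (a1 - b1) ^ 2 + (a2 - b2) ^ 2 := by
  set A := 1 + a1 ^ 2 + a2 ^ 2
  set B := 1 + b1 ^ 2 + b2 ^ 2
  have hA : 1 ≤ A := by nlinarith [sq_nonneg a1, sq_nonneg a2]
  have hB : 1 ≤ B := by nlinarith [sq_nonneg b1, sq_nonneg b2]
  have hα0 : α ≠ 0 := by rintro rfl; simp at h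
  have hβ0 : β ≠ 0 := by rintro rfl; simp at h
  have hα1 : α ^ 2 ≤ 1 := by nlinarith [sq_nonneg α]
  have hβ1 : β ^ 2 ≤ 1 := by nlinarith [sq_nonneg β]
  have hp1 : α * β ≤ 1 := by nlinarith [sq_nonneg (α - β)]
  have h2 : 2 ≤ α * β * (A + B) := by
    have eA : A = 1 / α ^ 2 := by rw [eq_div_iff (by positivity)]; linarith
    have eB : B = 1 / β ^ 2 := by rw [eq_div_iff (by positivity)]; linarith
    have : α * β * (A + B) = (α ^ 2 + β ^ 2) / (α * β) := by
      rw [eA, eB]; field_simp; ring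
    rw [this, le_div_iff₀ h]
    nlinarith [sq_nonneg (α - β)]
  set D := (a1 - b1) ^ 2 + (a2 - b2) ^ 2 with hD
  have hD0 : 0 ≤ D := by positivity
  have e : (α - β) ^ 2 + ((α * a1 - β * b1) ^ 2 + (α * a2 - β * b2) ^ 2) =
      α ^ 2 * A + β ^ 2 * B - α * β * (A + B) + α * β * D := by
    simp only [A, B, D]; ring
  rw [e, hα, hβ]
  nlinarith

lemma vv_sep (c : Fin 3) (ξ ξ' : E3) (h1 : ‖ξ‖ = 1) (h1' : ‖ξ'‖ = 1) (h : 1 / 2 ≤ |ξ c|)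
    (h' : 1 / 2 ≤ |ξ' c|) (hpos : 0 < ξ c * ξ' c) : ‖ξ - ξ'‖ ≤ 3 * ‖vv c ξ - vv c ξ'‖ := by
  have n1 := E3_norm_sq c ξ
  have n2 := E3_norm_sq c ξ'
  rw [h1, ← vv_mul c ξ h, ← vv_mul c ξ h] at n1
  rw [h1', ← vv_mul c ξ' h', ← vv_mul c ξ' h'] at n2
  have key := sep_alg (ξ c) (ξ' c) (vv c ξ 0) (vv c ξ 1) (vv c ξ' 0) (vv c ξ' 1)
    (by linarith) (by linarith) hpos
  rw [vv_mul c ξ h, vv_mul c ξ h, vv_mul c ξ' h', vv_mul c ξ' h'] at key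
  have n3 := E3_norm_sq c (ξ - ξ')
  simp only [PiLp.sub_apply] at n3
  rw [← n3] at key
  set s := ‖vv c ξ - vv c ξ'‖ with hs
  have hs0 : 0 ≤ s := norm_nonneg _
  have a0 : |vv c ξ 0 - vv c ξ' 0| ≤ s := WW_abs_le (vv c ξ - vv c ξ') 0
  have a1 : |vv c ξ 1 - vv c ξ' 1| ≤ s := WW_abs_le (vv c ξ - vv c ξ') 1
  have b0 := sq_le_sq' (abs_le.1 a0).1 (abs_le.1 a0).2
  have b1 := sq_le_sq' (abs_le.1 a1).1 (abs_le.1 a1).2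
  apply (abs_le_of_sq_le_sq' _ (by positivity)).2
  nlinarith

lemma big_coord (ξ : E3) (h1 : ‖ξ‖ = 1) : ∃ c, 1 / 2 ≤ |ξ c| := by
  by_contra! h
  have n1 := E3_norm_sq 0 ξ
  rw [h1] at n1
  have b : ∀ k, ξ k ^ 2 ≤ 1 / 4 := by
    intro k
    have := sq_le_sq' (abs_le.1 (h k).le).1 (abs_le.1 (h k).le).2
    linarith
  have := b 0; have := b (Fin.succAbove 0 0); have := b (Fin.succAbove 0 1)
  linarith

lemma class_bound (ε : ℝ) (hε : 0 < ε) : ∃ C > (0 : ℝ), ∀ (M : ℕ) (δ lam : ℝ) (E : Set E3)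
    (ξ a : Fin M → E3), 0 < M → δ < 1 / 4 → DiscretizedSetup 3 M δ lam E ξ a →
    (M * δ ^ 2) ^ 3 * lam ^ 10 * δ ^ 2 ≤ C * δ ^ (-ε) * (volume.real E) ^ 4 := by
  obtain ⟨C, hC, H⟩ := core_eps ε hε
  refine ⟨576 ^ 10 * C, by positivity, ?_⟩
  rintro M δ lam E ξ a hM hδ4 ⟨hδ, -, ⟨hl, hl1⟩, hEm, hEb, hξ, hsep, hmass⟩
  have hlam : 0 < lam := by linarith
  have hEfin : volume E ≠ ∞ := ((measure_mono hEb).trans_lt measure_ball_lt_top).ne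
  have hc : ∀ i, ∃ c, 1 / 2 ≤ |ξ i c| := fun i => big_coord (ξ i) (hξ i)
  choose c hc using hc
  classical
  let cls : Fin M → Fin 3 × Bool := fun i => (c i, decide (0 < ξ i (c i)))
  obtain ⟨b, hb⟩ : ∃ b, M ≤ 6 * (Finset.univ.filter (fun i => cls i = b)).card := by
    by_contra! h
    have h1 := Finset.card_eq_sum_card_fiberwise (s := (Finset.univ : Finset (Fin M)))
      (t := (Finset.univ : Finset (Fin 3 × Bool))) (f := cls) (fun _ _ => by simp)
    have h2 : ∑ b : Fin 3 × Bool, 6 * (Finset.univ.filter (fun i => cls i = b)).card <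
        ∑ b : Fin 3 × Bool, M := Finset.sum_lt_sum_of_nonempty ⟨(0, true), by simp⟩ (fun b _ => h b)
    rw [← Finset.mul_sum, ← h1] at h2
    simp at h2
  let ι := {i : Fin M // cls i = b}
  have hcard : Fintype.card ι = (Finset.univ.filter (fun i => cls i = b)).card :=
    Fintype.card_subtype _
  rw [← hcard] at hb
  have hne : Nonempty ι := by
    rw [← Fintype.card_pos_iff]; omega
  set k := b.1 with hk
  have hck : ∀ i : ι, c i.1 = k := fun i => congrArg Prod.fst i.2
  have hbig : ∀ i : ι, 1 / 2 ≤ |ξ i.1 k| := fun i => by rw [← hck i]; exact hc i.1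
  have hsgn : ∀ i j : ι, 0 < ξ i.1 k * ξ j.1 k := by
    intro i j
    have e1 : decide (0 < ξ i.1 k) = b.2 := by rw [← hck i]; exact congrArg Prod.snd i.2
    have e2 : decide (0 < ξ j.1 k) = b.2 := by rw [← hck j]; exact congrArg Prod.snd j.2
    have e3 := hbig i
    have e4 := hbig j
    have e5 := e1.trans e2.symm
    rw [decide_eq_decide] at e5
    by_cases h : 0 < ξ i.1 k
    · exact mul_pos h (e5.1 h)
    · have h' : ¬ 0 < ξ j.1 k := fun h2 => h (e5.2 h2)
      apply mul_pos_of_neg_of_neg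
      · rcases lt_trichotomy (ξ i.1 k) 0 with q | q | q
        · exact q
        · rw [q] at e3; norm_num at e3
        · exact absurd q h
      · rcases lt_trichotomy (ξ j.1 k) 0 with q | q | q
        · exact q
        · rw [q] at e4; norm_num at e4
        · exact absurd q h'
  have htm : ∀ i, MeasurableSet (tube 3 δ (ξ i) (a i)) := by
    intro i
    apply IsClosed.measurableSet
    have g1 : IsClosed {x : E3 | abs ⟪x - a i, ξ i⟫ ≤ 1 / 2} := isClosed_le (by fun_prop) (by fun_prop)
    have g2 : IsClosed {x : E3 | ‖(x - a i) - ⟪x - a i, ξ i⟫ • ξ i‖ ≤ δ} :=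
      isClosed_le (by fun_prop) (by fun_prop)
    exact g1.inter g2
  have hmp := (eqv_mp k).symm (eqv k)
  let Y : ι → Set XX := fun i => (eqv k).symm ⁻¹' (E ∩ tube 3 δ (ξ i.1) (a i.1))
  have hYm : ∀ i, MeasurableSet (Y i) := fun i => (eqv k).symm.measurable (hEm.inter (htm _))
  have hYv : ∀ i, volume (Y i) = volume (E ∩ tube 3 δ (ξ i.1) (a i.1)) := fun i =>
    hmp.measure_preimage (hEm.inter (htm _)).nullMeasurableSet
  have hV : volume.real (⋃ i, Y i) ≤ volume.real E := by
    have : volume.real ((eqv k).symm ⁻¹' E) = volume.real E := by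
      rw [measureReal_def, measureReal_def, hmp.measure_preimage hEm.nullMeasurableSet]
    rw [← this]
    apply measureReal_mono
    · exact iUnion_subset fun i z hz => hz.1
    · rw [hmp.measure_preimage hEm.nullMeasurableSet]; exact hEfin
  have key := H ι (fun i => pp k (ξ i.1) (a i.1)) (fun i => vv k (ξ i.1)) Y (3 * δ) (lam / 576)
    (by positivity) (by linarith) (by positivity) (by linarith)
    (fun i => vv_norm k _ (hξ _) (hbig i))
    (fun i j hij => by
      have h1 := hsep i.1 j.1 (fun h => hij (Subtype.ext h))
      rw [dist_eq_norm] at h1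
      have h2 := vv_sep k _ _ (hξ i.1) (hξ j.1) (hbig i) (hbig j) (hsgn i j)
      linarith)
    hYm
    (fun i z hz => by
      have h1 := tube_sub k (ξ i.1) (a i.1) ((eqv k).symm z) δ (hξ _) (hbig i) hδ hz.2
        (by have := hEb hz.1; rw [mem_ball_zero_iff] at this; exact this.le)
      rwa [MeasurableEquiv.apply_symm_apply] at h1)
    (fun i => by
      rw [measureReal_def, hYv]
      have h1 := hmass i.1
      have h2 := tube_vol k (ξ i.1) (a i.1) δ (hξ _) (hbig i) hδ (by linarith)
      have h3 : ENNReal.ofReal (lam / 576 * (3 * δ) ^ 2) ≤ volume (E ∩ tube 3 δ (ξ i.1) (a i.1)) := by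
        refine le_trans ?_ h1
        refine le_trans ?_ (mul_le_mul_right h2 _)
        rw [← ENNReal.ofReal_mul (by positivity)]
        apply le_of_eq; congr 1; ring
      exact (ENNReal.ofReal_le_iff_le_toReal
        ((measure_mono inter_subset_left).trans_lt hEfin.lt_top).ne).1 h3)
  set V := volume.real E with hVd
  set V' := volume.real (⋃ i, Y i) with hV'
  have hV'0 : 0 ≤ V' := measureReal_nonneg
  have hMc : (M : ℝ) ≤ 6 * Fintype.card ι := by exact_mod_cast hb
  set m : ℝ := (Fintype.card ι : ℝ) with hm
  have h1 : (3 * δ) ^ (-ε) ≤ δ ^ (-ε) :=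
    Real.rpow_le_rpow_of_nonpos hδ (by linarith) (by linarith)
  have h2 : (M * δ ^ 2) ^ 3 * lam ^ 10 * δ ^ 2 ≤
      576 ^ 10 * ((lam / 576) ^ 10 * (m * (3 * δ) ^ 2) ^ 3 * (3 * δ) ^ 2) := by
    have : (M : ℝ) * δ ^ 2 ≤ m * (3 * δ) ^ 2 := by nlinarith [sq_nonneg δ]
    calc (M * δ ^ 2) ^ 3 * lam ^ 10 * δ ^ 2 ≤ (m * (3 * δ) ^ 2) ^ 3 * lam ^ 10 * (3 * δ) ^ 2 := by
          gcongr
          linarith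
      _ = _ := by ring
  calc _ ≤ _ := h2
    _ ≤ 576 ^ 10 * (C * δ ^ (-ε) * V ^ 4) := by
        apply mul_le_mul_of_nonneg_left _ (by positivity)
        refine key.trans ?_
        gcongr
    _ = _ := by ring

/-- **Discretized form (2.2), d = 3.** For every `ε > 0` there exist `C_ε > 0`, `δ₀ > 0` such
that in the discretized setup with `d = 3` and `δ ∈ (0,δ₀)`:
`M δ² ≤ C_ε (λ^{-5/2} δ^{-1/2-ε} |E|)^{4/3}`. -/
theorem discretized_form_dim3 :
    ∀ ε > (0 : ℝ), ∃ C > (0 : ℝ), ∃ δ₀ > (0 : ℝ),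
      ∀ (M : ℕ) (δ lam : ℝ) (E : Set (EuclideanSpace ℝ (Fin 3)))
        (ξ a : Fin M → EuclideanSpace ℝ (Fin 3)),
        δ < δ₀ → DiscretizedSetup 3 M δ lam E ξ a →
          (M : ℝ≥0∞) * ENNReal.ofReal (δ ^ 2) ≤
            ENNReal.ofReal C *
              (ENNReal.ofReal (lam ^ (-(5 / 2) : ℝ) * δ ^ (-(1 / 2 : ℝ) - ε)) * volume E) ^
                (4 / 3 : ℝ) := by
  intro ε hε
  obtain ⟨C, hC, H⟩ := class_bound (4 * ε) (by positivity)
  refine ⟨C ^ (1 / 3 : ℝ), by positivity, 1 / 4, by norm_num, ?_⟩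
  intro M δ lam E ξ a hδ4 hset
  rcases Nat.eq_zero_or_pos M with hM | hM
  · subst hM; simp
  have key := H M δ lam E ξ a hM hδ4 hset
  obtain ⟨hδ, -, ⟨hl, hl1⟩, hEm, hEb, -⟩ := hset
  have hlam : 0 < lam := by linarith
  have hEfin : volume E ≠ ∞ := ((measure_mono hEb).trans_lt measure_ball_lt_top).ne
  set V := volume.real E with hV
  have hV0 : 0 ≤ V := measureReal_nonneg
  have hVE : volume E = ENNReal.ofReal V := (ofReal_measureReal hEfin).symm
  set q := lam ^ (-(5 / 2) : ℝ) * δ ^ (-(1 / 2 : ℝ) - ε) * V with hq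
  have hq0 : 0 ≤ q := by positivity
  have hq4 : q ^ 4 * (lam ^ 10 * δ ^ 2) = δ ^ (-(4 * ε)) * V ^ 4 := by
    have e1 : (lam ^ (-(5 / 2) : ℝ)) ^ 4 * lam ^ 10 = 1 := by
      rw [← Real.rpow_natCast, ← Real.rpow_natCast, ← Real.rpow_mul hlam.le, ← Real.rpow_add hlam]
      norm_num
    have e2 : (δ ^ (-(1 / 2 : ℝ) - ε)) ^ 4 * δ ^ 2 = δ ^ (-(4 * ε)) := by
      rw [← Real.rpow_natCast, ← Real.rpow_natCast, ← Real.rpow_mul hδ.le, ← Real.rpow_add hδ]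
      congr 1; push_cast; ring
    rw [← e2, hq]
    calc _ = ((lam ^ (-(5 / 2) : ℝ)) ^ 4 * lam ^ 10) * ((δ ^ (-(1 / 2 : ℝ) - ε)) ^ 4 * δ ^ 2 * V ^ 4) := by ring
      _ = _ := by rw [e1, one_mul]
  have h3 : (M * δ ^ 2) ^ 3 ≤ C * q ^ 4 := by
    have hp : 0 < lam ^ 10 * δ ^ 2 := by positivity
    apply le_of_mul_le_mul_right _ hp
    calc _ = (M * δ ^ 2) ^ 3 * lam ^ 10 * δ ^ 2 := by ring
      _ ≤ _ := key
      _ = _ := by rw [mul_assoc, mul_assoc, hq4]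
  have h4 : M * δ ^ 2 ≤ C ^ (1 / 3 : ℝ) * q ^ (4 / 3 : ℝ) := by
    have := Real.rpow_le_rpow (by positivity) h3 (by norm_num : (0 : ℝ) ≤ 1 / 3)
    rw [Real.mul_rpow hC.le (by positivity), ← Real.rpow_natCast, ← Real.rpow_mul (by positivity),
      ← Real.rpow_natCast q, ← Real.rpow_mul hq0] at this
    norm_num at this
    norm_num
    exact this
  rw [hVE, ← ENNReal.ofReal_mul (by positivity), ENNReal.ofReal_rpow_of_nonneg hq0 (by norm_num),
    ← ENNReal.ofReal_mul (by positivity), ← ENNReal.ofReal_natCast, ← ENNReal.ofReal_mul (by positivity)]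
  exact ENNReal.ofReal_le_ofReal h4
end
end

section
/- (Lemma 4.1: measure lower bound in the low multiplicity scenario) In the discretized setup, if the positive integer N satisfies scenario I, then |E| ≥ λ M |T^δ| / (16 N), where |T^δ| is the common Lebesgue measure of a δ-tube in ℝ^d (so |E| ≥ c_d λ M δ^{d-1} / N for a constant c_d > 0 depending only on d). -/
open MeasureTheory Metric Set
open scoped ENNReal RealInnerProductSpace

noncomputable section

theorem isClosed_tube_aux (d : ℕ) (δ : ℝ) (ξ a : EuclideanSpace ℝ (Fin d)) :
    IsClosed (tube d δ ξ a) := by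
  unfold tube
  have h1 : IsClosed {x : EuclideanSpace ℝ (Fin d) | abs ⟪x - a, ξ⟫ ≤ 1 / 2} :=
    isClosed_le (by fun_prop) continuous_const
  have h2 : IsClosed {x : EuclideanSpace ℝ (Fin d) | ‖(x - a) - ⟪x - a, ξ⟫ • ξ‖ ≤ δ} :=
    isClosed_le (by fun_prop) continuous_const
  exact h1.inter h2

theorem volume_tube_aux (d : ℕ) (δ : ℝ) (ξ η a : EuclideanSpace ℝ (Fin d))
    (h : ‖ξ‖ = ‖η‖) : volume (tube d δ ξ a) = volume (tube d δ η 0) := by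
  let L : EuclideanSpace ℝ (Fin d) ≃ₗᵢ[ℝ] EuclideanSpace ℝ (Fin d) :=
    Submodule.reflection (Submodule.span ℝ {ξ - η})ᗮ
  have hL : L ξ = η := Submodule.reflection_sub h
  have h1 : tube d δ ξ a = (fun x => x - a) ⁻¹' (L ⁻¹' (tube d δ η 0)) := by
    ext x
    simp only [tube, Set.mem_preimage, Set.mem_setOf_eq, sub_zero]
    rw [← hL, L.inner_map_map, ← L.map_smul, ← L.map_sub, L.norm_map]
  simp only [h1, sub_eq_add_neg]
  rw [measure_preimage_add_right]
  exact L.measurePreserving.measure_preimage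
    (isClosed_tube_aux d δ η 0).measurableSet.nullMeasurableSet

theorem sum_measure_aux (d M : ℕ) (E : Set (EuclideanSpace ℝ (Fin d)))
    (hE : MeasurableSet E) (T : Fin M → Set (EuclideanSpace ℝ (Fin d)))
    (hT : ∀ j, MeasurableSet (T j)) (N : ℕ) (J : Finset (Fin M)) :
    ∑ j ∈ J, volume (T j ∩ E ∩ {x | {l : Fin M | l ≠ j ∧ x ∈ T l}.ncard ≤ N}) ≤
      ((N + 1 : ℕ) : ℝ≥0∞) * volume E := by
  classical
  have hA : ∀ j, MeasurableSet (T j ∩ E ∩ {x | {l : Fin M | l ≠ j ∧ x ∈ T l}.ncard ≤ N}) := by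
    intro j
    refine ((hT j).inter hE).inter ?_
    have : (fun x => {l : Fin M | l ≠ j ∧ x ∈ T l}.ncard) =
        fun x => ∑ l ∈ Finset.univ.filter (fun l => l ≠ j), (T l).indicator (fun _ => 1) x := by
      funext x
      rw [Set.ncard_eq_toFinset_card']
      simp only [Set.indicator_apply, Finset.sum_boole, Finset.filter_filter]
      simp
    have hm : Measurable (fun x => {l : Fin M | l ≠ j ∧ x ∈ T l}.ncard) := by
      rw [this]
      exact Finset.measurable_sum _ fun l _ => measurable_const.indicator (hT l)
    exact measurableSet_le hm measurable_const
  calc _ = ∑ j ∈ J, ∫⁻ x, (T j ∩ E ∩ {x | {l : Fin M | l ≠ j ∧ x ∈ T l}.ncard ≤ N}).indicator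
            (fun _ => (1 : ℝ≥0∞)) x := by
        refine Finset.sum_congr rfl fun j _ => ?_
        rw [lintegral_indicator_const (hA j), one_mul]
    _ = ∫⁻ x, ∑ j ∈ J, (T j ∩ E ∩ {x | {l : Fin M | l ≠ j ∧ x ∈ T l}.ncard ≤ N}).indicator
            (fun _ => (1 : ℝ≥0∞)) x :=
        (lintegral_finsetSum _ fun j _ => measurable_const.indicator (hA j)).symm
    _ ≤ ∫⁻ x, E.indicator (fun _ => ((N + 1 : ℕ) : ℝ≥0∞)) x := by
        refine lintegral_mono fun x => ?_
        simp only [Set.indicator_apply, Finset.sum_boole]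
        by_cases hx : ∃ j ∈ J, x ∈ T j ∩ E ∩ {x | {l : Fin M | l ≠ j ∧ x ∈ T l}.ncard ≤ N}
        · obtain ⟨j, hj, ⟨hxT, hxE⟩, hN⟩ := hx
          rw [if_pos hxE]
          norm_cast
          simp only [Set.mem_setOf_eq] at hN
          rw [← Set.ncard_coe_finset]
          calc _ ≤ (insert j {l : Fin M | l ≠ j ∧ x ∈ T l}).ncard := by
                refine Set.ncard_le_ncard ?_ (Set.toFinite _)
                intro l hl
                simp only [Finset.coe_filter, Set.mem_setOf_eq, Set.mem_inter_iff] at hl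
                by_cases h : l = j
                · exact Or.inl h
                · exact Or.inr ⟨h, hl.2.1.1⟩
            _ ≤ _ := (Set.ncard_insert_le _ _).trans (by omega)
        · push Not at hx
          rw [Finset.filter_false_of_mem hx]
          simp
    _ = _ := lintegral_indicator_const hE _

/-- **Lemma 4.1: measure lower bound in the low multiplicity scenario.** In the discretized
setup, if the positive integer `N` satisfies scenario I, then `|E| ≥ λ M |T^δ|/(16N)`, where
`|T^δ|` is the common Lebesgue measure of a δ-tube in `ℝ^d`. -/
theorem low_multiplicity_measure_lower_bound :
    ∀ d M : ℕ, ∀ hd : 3 ≤ d,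
      ∀ (δ lam : ℝ) (E : Set (EuclideanSpace ℝ (Fin d)))
        (ξ a : Fin M → EuclideanSpace ℝ (Fin d)),
        DiscretizedSetup d M δ lam E ξ a →
          ∀ N : ℕ, 0 < N → ScenarioI d M δ lam E ξ a N →
            ENNReal.ofReal (lam * M / (16 * N)) *
                volume (tube d δ (EuclideanSpace.single (⟨0, by omega⟩ : Fin d) (1 : ℝ)) 0) ≤
              volume E := by
  intro d M hd δ lam E ξ a hS N hN hI
  obtain ⟨hδ, hδ1, hlam, hE, hEb, hξ, hsep, hdens⟩ := hS
  set V := volume (tube d δ (EuclideanSpace.single (⟨0, by omega⟩ : Fin d) (1 : ℝ)) 0) with hV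
  have hvol : ∀ j, volume (tube d δ (ξ j) (a j)) = V := fun j =>
    volume_tube_aux d δ _ _ _ (by rw [hξ j]; simp)
  classical
  unfold ScenarioI at hI
  rw [Set.ncard_eq_toFinset_card'] at hI
  set J := Set.toFinset {j : Fin M | ENNReal.ofReal (lam / 4) * volume (tube d δ (ξ j) (a j)) ≤
      volume (tube d δ (ξ j) (a j) ∩ E ∩
        {x | ({l : Fin M | l ≠ j ∧ x ∈ tube d δ (ξ l) (a l)}.ncard ≤ N)})} with hJ
  have hsum := sum_measure_aux d M E hE (fun j => tube d δ (ξ j) (a j))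
    (fun j => (isClosed_tube_aux d δ _ _).measurableSet) N J
  have hlow : (J.card : ℝ≥0∞) * (ENNReal.ofReal (lam / 4) * V) ≤
      ((N + 1 : ℕ) : ℝ≥0∞) * volume E := by
    refine le_trans ?_ hsum
    rw [← nsmul_eq_mul]
    refine Finset.card_nsmul_le_sum _ _ _ fun j hj => ?_
    have := (Set.mem_toFinset.1 hj)
    simp only [Set.mem_setOf_eq] at this
    rwa [hvol j] at this
  have hlam0 : 0 ≤ lam := hδ.le.trans hlam.1
  have hNpos : (0 : ℝ) < N := by exact_mod_cast hN
  have hN1 : (1 : ℝ) ≤ N := by exact_mod_cast hN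
  have hc : ((N + 1 : ℕ) : ℝ≥0∞) * ENNReal.ofReal (lam * M / (16 * N)) ≤
      (J.card : ℝ≥0∞) * ENNReal.ofReal (lam / 4) := by
    rw [← ENNReal.ofReal_natCast (N + 1), ← ENNReal.ofReal_natCast J.card,
      ← ENNReal.ofReal_mul (by positivity), ← ENNReal.ofReal_mul (by positivity)]
    apply ENNReal.ofReal_le_ofReal
    push_cast
    calc ((N : ℝ) + 1) * (lam * M / (16 * N)) ≤ (2 * N) * (lam * M / (16 * N)) := by
          apply mul_le_mul_of_nonneg_right (by linarith) (by positivity)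
      _ = (M / 2) * (lam / 4) := by field_simp; ring
      _ ≤ _ := mul_le_mul_of_nonneg_right hI (by positivity)
  have h0 : ((N + 1 : ℕ) : ℝ≥0∞) ≠ 0 := by simp
  have ht : ((N + 1 : ℕ) : ℝ≥0∞) ≠ ⊤ := ENNReal.natCast_ne_top _
  rw [← ENNReal.mul_le_mul_iff_right h0 ht, ← mul_assoc]
  refine le_trans ?_ hlow
  rw [← mul_assoc]
  gcongr
end
end

section
/- (Counting tubes through a dense subset of a fixed tube, eq. (5.5)) Let d = 3. There is an absolute constant c > 0 such that for all sufficiently small δ ∈ (0,1) the following holds: let θ ∈ [δ,1], λ ∈ (0,1], N a positive integer, T^δ_j a δ-tube, S ⊂ T^δ_j a measurable set with |S| ≥ 2^{-3} (4 log₂(1/δ))^{-2} λ |T^δ_j|, and let T^δ_{i_1}, …, T^δ_{i_{M₀}} be δ-tubes each of whose direction makes an angle in [θ/2, θ) with the direction of T^δ_j, such that Σ_{k=1}^{M₀} χ_{T^δ_{i_k}}(x) ≥ 2^{-3} (log₂(1/δ))^{-2} N for every x ∈ S. Then M₀ ≥ c θ δ^{-1} N λ (log₂(1/δ))^{-4}.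 -/
open MeasureTheory Metric Set
open scoped ENNReal RealInnerProductSpace

noncomputable section

/-- Volume of a box with respect to an orthonormal basis. -/
theorem volume_obox (e : OrthonormalBasis (Fin 3) ℝ (EuclideanSpace ℝ (Fin 3)))
    (c r : Fin 3 → ℝ) :
    volume {x : EuclideanSpace ℝ (Fin 3) | ∀ i, |⟪e i, x⟫ - c i| ≤ r i}
      = ∏ i, ENNReal.ofReal (2 * r i) := by
  have h1 : {x : EuclideanSpace ℝ (Fin 3) | ∀ i, |⟪e i, x⟫ - c i| ≤ r i}
      = e.repr ⁻¹' (WithLp.ofLp ⁻¹' (Icc (c - r) (c + r))) := by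
    ext x
    simp only [mem_ofPred_eq, mem_preimage, mem_Icc, Pi.le_def, Pi.sub_apply, Pi.add_apply,
      OrthonormalBasis.repr_apply_apply, ← forall_and, abs_le]
    refine forall_congr' fun i => ?_
    constructor <;> rintro ⟨h, h'⟩ <;> constructor <;> linarith
  have hm : MeasurableSet (Icc (c - r) (c + r)) := measurableSet_Icc
  rw [h1, e.measurePreserving_repr.measure_preimage
    ((PiLp.volume_preserving_ofLp (Fin 3)).measurable hm).nullMeasurableSet,
    (PiLp.volume_preserving_ofLp (Fin 3)).measure_preimage hm.nullMeasurableSet,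
    Real.volume_Icc_pi]
  refine Finset.prod_congr rfl fun i _ => ?_
  congr 1
  simp only [Pi.sub_apply, Pi.add_apply]
  ring

theorem tube_perp {δ : ℝ} {ξ a x u : EuclideanSpace ℝ (Fin 3)} (hx : x ∈ tube 3 δ ξ a)
    (hu : ‖u‖ = 1) (hp : ⟪u, ξ⟫ = 0) : |⟪u, x - a⟫| ≤ δ := by
  have h := abs_real_inner_le_norm u ((x - a) - ⟪x - a, ξ⟫ • ξ)
  rw [inner_sub_right, inner_smul_right, hp, hu, mul_zero, sub_zero, one_mul] at h
  exact h.trans hx.2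

theorem measurableSet_tube (δ : ℝ) (ξ a : EuclideanSpace ℝ (Fin 3)) :
    MeasurableSet (tube 3 δ ξ a) := by
  apply IsClosed.measurableSet
  have h1 : IsClosed {x : EuclideanSpace ℝ (Fin 3) | |⟪x - a, ξ⟫| ≤ 1 / 2} :=
    isClosed_le (by fun_prop) continuous_const
  have h2 : IsClosed {x : EuclideanSpace ℝ (Fin 3) | ‖(x - a) - ⟪x - a, ξ⟫ • ξ‖ ≤ δ} :=
    isClosed_le (by fun_prop) continuous_const
  exact h1.inter h2

theorem volume_tube_ge {δ : ℝ} (hδ : 0 < δ) (ξ a : EuclideanSpace ℝ (Fin 3)) (hξ : ‖ξ‖ = 1) :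
    ENNReal.ofReal (δ ^ 2) ≤ volume (tube 3 δ ξ a) := by
  obtain ⟨e, he⟩ := Orthonormal.exists_orthonormalBasis_extension_of_card_eq
    (𝕜 := ℝ) (E := EuclideanSpace ℝ (Fin 3)) (ι := Fin 3) (by simp)
    (v := fun _ => ξ) (s := {0}) (by
      constructor
      · intro i; simpa using hξ
      · intro i j hij; exact absurd (Subsingleton.elim i j) hij)
  have he0 : e 0 = ξ := he 0 rfl
  have hv := volume_obox e (fun i => ⟪e i, a⟫) ![1 / 2, δ / 2, δ / 2]
  have : ENNReal.ofReal (δ ^ 2) =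
      ∏ i, ENNReal.ofReal (2 * (![1 / 2, δ / 2, δ / 2] : Fin 3 → ℝ) i) := by
    rw [← ENNReal.ofReal_prod_of_nonneg]
    · congr 1
      simp [Fin.prod_univ_three]; ring
    · intro i _; fin_cases i <;> simp <;> positivity
  rw [this, ← hv]
  apply measure_mono
  intro x hx
  simp only [mem_ofPred_eq, ← inner_sub_right] at hx
  have h0 := hx 0
  have h1 := hx 1
  have h2 := hx 2
  simp at h0 h1 h2
  refine ⟨by rw [real_inner_comm, ← he0]; simpa using h0, ?_⟩
  have hs := e.sum_repr' (x - a)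
  rw [Fin.sum_univ_three] at hs
  have h3 : (x - a) - ⟪x - a, ξ⟫ • ξ = ⟪e 1, x - a⟫ • e 1 + ⟪e 2, x - a⟫ • e 2 := by
    rw [real_inner_comm, ← he0]
    nth_rewrite 1 [← hs]
    abel
  rw [h3]
  refine (norm_add_le _ _).trans ?_
  rw [norm_smul, norm_smul, e.norm_eq_one, e.norm_eq_one]
  simp only [Real.norm_eq_abs]
  linarith

theorem volume_inter_le {δ : ℝ} (hδ : 0 < δ) (ξ a η b : EuclideanSpace ℝ (Fin 3)) (hξ : ‖ξ‖ = 1)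
    (hη : ‖η‖ = 1) (s : ℝ) (hs : 0 < s) (hs2 : s ^ 2 + ⟪η, ξ⟫ ^ 2 = 1) :
    volume (tube 3 δ ξ a ∩ tube 3 δ η b) ≤ ENNReal.ofReal (16 * δ ^ 3 / s) := by
  set g : ℝ := ⟪η, ξ⟫ with hg
  set f : EuclideanSpace ℝ (Fin 3) := s⁻¹ • (η - g • ξ) with hf
  have hξξ : ⟪ξ, ξ⟫ = 1 := by rw [real_inner_self_eq_norm_sq, hξ]; norm_num
  have hηη : ⟪η, η⟫ = 1 := by rw [real_inner_self_eq_norm_sq, hη]; norm_num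
  have hfξ : ⟪f, ξ⟫ = 0 := by
    rw [hf, real_inner_smul_left, inner_sub_left, real_inner_smul_left, hξξ, ← hg]; ring
  have hfη : ⟪f, η⟫ = s := by
    rw [hf, real_inner_smul_left, inner_sub_left, real_inner_smul_left, hηη,
      real_inner_comm, ← hg]
    field_simp; linarith
  have hff : ⟪f, f⟫ = 1 := by
    have : ⟪f, f⟫ = ⟪f, s⁻¹ • (η - g • ξ)⟫ := by rw [← hf]
    rw [this, real_inner_smul_right, inner_sub_right, real_inner_smul_right, hfξ, hfη]
    field_simp; ring
  have hfn : ‖f‖ = 1 := by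
    rw [real_inner_self_eq_norm_sq] at hff
    nlinarith [norm_nonneg f]
  have hξf : ⟪ξ, f⟫ = 0 := by rw [real_inner_comm, hfξ]
  clear_value f
  set u : EuclideanSpace ℝ (Fin 3) := g • f - s • ξ with hu
  have huη : ⟪u, η⟫ = 0 := by
    rw [hu, inner_sub_left, real_inner_smul_left, real_inner_smul_left, hfη,
      real_inner_comm, ← hg]; ring
  have hun : ‖u‖ = 1 := by
    have : ⟪u, u⟫ = 1 := by
      rw [hu]
      simp only [inner_sub_left, inner_sub_right, real_inner_smul_left, real_inner_smul_right,
        hfξ, hff, hξξ, hξf]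
      linarith
    rw [real_inner_self_eq_norm_sq] at this
    nlinarith [norm_nonneg u]
  obtain ⟨e, he⟩ := Orthonormal.exists_orthonormalBasis_extension_of_card_eq
    (𝕜 := ℝ) (E := EuclideanSpace ℝ (Fin 3)) (ι := Fin 3) (by simp)
    (v := ![ξ, f, 0]) (s := {0, 1}) (by
      constructor
      · rintro ⟨i, rfl | rfl⟩ <;> simpa
      · rintro ⟨i, rfl | rfl⟩ ⟨j, rfl | rfl⟩ hij
        · exact absurd rfl hij
        · simpa using hξf
        · simpa using hfξ
        · exact absurd rfl hij)
  have he0 : e 0 = ξ := he 0 (by simp)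
  have he1 : e 1 = f := he 1 (by simp)
  have hgle : |g| ≤ 1 := by
    rw [← sq_le_one_iff_abs_le_one]; nlinarith
  have hv := volume_obox e ![s⁻¹ * (g * ⟪f, a⟫ - ⟪u, b⟫), ⟪e 1, a⟫, ⟪e 2, a⟫]
    ![2 * δ / s, δ, δ]
  have : ENNReal.ofReal (16 * δ ^ 3 / s) =
      ∏ i, ENNReal.ofReal (2 * (![2 * δ / s, δ, δ] : Fin 3 → ℝ) i) := by
    rw [← ENNReal.ofReal_prod_of_nonneg]
    · congr 1
      simp [Fin.prod_univ_three]; ring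
    · intro i _; fin_cases i <;> simp <;> positivity
  rw [this, ← hv]
  apply measure_mono
  rintro x ⟨hx, hy⟩
  have k1 := tube_perp hx hfn hfξ
  have k2 := tube_perp hx (u := e 2) (by simp) (by
    rw [← he0]; exact e.orthonormal.2 (by decide))
  have k3 := tube_perp hy hun huη
  rw [mem_ofPred_eq]
  intro i
  fin_cases i
  · simp only [Fin.zero_eta, Matrix.cons_val_zero, he0]
    have key : ⟪ξ, x⟫ - s⁻¹ * (g * ⟪f, a⟫ - ⟪u, b⟫)
        = s⁻¹ * (g * ⟪f, x - a⟫ - ⟪u, x - b⟫) := by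
      have : ⟪u, x⟫ = g * ⟪f, x⟫ - s * ⟪ξ, x⟫ := by
        rw [hu, inner_sub_left, real_inner_smul_left, real_inner_smul_left]
      rw [inner_sub_right, inner_sub_right, this]
      field_simp; ring
    rw [key, abs_mul, abs_of_pos (inv_pos.2 hs), div_eq_inv_mul]
    refine mul_le_mul_of_nonneg_left ?_ (inv_pos.2 hs).le
    refine (abs_sub _ _).trans ?_
    rw [abs_mul]
    nlinarith [abs_nonneg g, abs_nonneg ⟪f, x - a⟫]
  · simpa [inner_sub_right, he1] using k1
  · simpa [inner_sub_right] using k2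

/-- **Counting tubes through a dense subset of a fixed tube (eq. (5.5)), `d = 3`.** There is
an absolute constant `c > 0` such that for all sufficiently small `δ`: if `S ⊆ T^δ_j` has
`|S| ≥ 2^{-3}(4 log₂(1/δ))^{-2} λ |T^δ_j|`, and `T^δ_{i_1},…,T^δ_{i_{M₀}}` are δ-tubes whose
directions make an angle in `[θ/2,θ)` with that of `T^δ_j` and which satisfy
`Σ_k χ_{T^δ_{i_k}}(x) ≥ 2^{-3}(log₂(1/δ))^{-2} N` for every `x ∈ S`, then
`M₀ ≥ c θ δ^{-1} N λ (log₂(1/δ))^{-4}`. -/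
theorem tube_counting_through_dense_subset :
    ∃ c > (0 : ℝ), ∃ δ₀ > (0 : ℝ), ∀ δ : ℝ, δ ∈ Set.Ioo 0 δ₀ →
      ∀ (θ lam : ℝ) (N : ℕ), θ ∈ Set.Icc δ 1 → lam ∈ Set.Ioc (0 : ℝ) 1 → 0 < N →
      ∀ (ξj aj : EuclideanSpace ℝ (Fin 3)), ‖ξj‖ = 1 →
      ∀ S : Set (EuclideanSpace ℝ (Fin 3)), MeasurableSet S → S ⊆ tube 3 δ ξj aj →
        ENNReal.ofReal ((2 ^ 3)⁻¹ * (4 * Real.logb 2 (1 / δ))⁻¹ ^ 2 * lam) *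
            volume (tube 3 δ ξj aj) ≤ volume S →
      ∀ (M₀ : ℕ) (η b : Fin M₀ → EuclideanSpace ℝ (Fin 3)),
        (∀ k, ‖η k‖ = 1) →
        (∀ k, InnerProductGeometry.angle (η k) ξj ∈ Set.Ico (θ / 2) θ) →
        (∀ x ∈ S, (2 ^ 3 : ℝ)⁻¹ * (Real.logb 2 (1 / δ))⁻¹ ^ 2 * N ≤
          ({k : Fin M₀ | x ∈ tube 3 δ (η k) (b k)}.ncard : ℝ)) →
        c * θ * δ⁻¹ * N * lam * (Real.logb 2 (1 / δ))⁻¹ ^ 4 ≤ (M₀ : ℝ) := by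
  refine ⟨1 / 2 ^ 16, by positivity, 1, one_pos, ?_⟩
  rintro δ ⟨hδ, hδ1⟩ θ lam N ⟨hθδ, hθ1⟩ ⟨hl0, hl1⟩ hN ξj aj hξ S hS hST hvol M₀ η b hη hang hcount
  have hθ : 0 < θ := hδ.trans_le hθδ
  set L := (Real.logb 2 (1 / δ))⁻¹ with hL
  have hinter : ∀ k, volume (tube 3 δ (η k) (b k) ∩ S) ≤ ENNReal.ofReal (64 * δ ^ 3 / θ) := by
    intro k
    obtain ⟨hk1, hk2⟩ := hang k
    set α := InnerProductGeometry.angle (η k) ξj with hα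
    have hcos : ⟪η k, ξj⟫ = Real.cos α := by
      rw [hα, InnerProductGeometry.cos_angle, hη k, hξ]; simp
    have hpi := Real.pi_gt_three
    have hpi4 := Real.pi_le_four
    have hsin : θ / 4 ≤ Real.sin α := by
      have h := Real.mul_le_sin (x := α) (by linarith) (by linarith)
      refine le_trans ?_ h
      have h1 : (1 / 2 : ℝ) ≤ 2 / Real.pi := by
        rw [div_le_div_iff₀ (by norm_num) Real.pi_pos]; linarith
      nlinarith
    have hsp : 0 < Real.sin α := by linarith
    have h := volume_inter_le hδ ξj aj (η k) (b k) hξ (hη k) (Real.sin α) hsp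
      (by rw [hcos]; exact Real.sin_sq_add_cos_sq α)
    have hsub : tube 3 δ (η k) (b k) ∩ S ⊆ tube 3 δ ξj aj ∩ tube 3 δ (η k) (b k) :=
      fun x hx => ⟨hST hx.2, hx.1⟩
    refine (measure_mono hsub).trans (h.trans ?_)
    apply ENNReal.ofReal_le_ofReal
    rw [div_le_div_iff₀ hsp hθ]
    have : 0 < δ ^ 3 := by positivity
    nlinarith
  have hmain : ENNReal.ofReal ((2 ^ 3 : ℝ)⁻¹ * L ^ 2 * N) * volume S
      ≤ M₀ * ENNReal.ofReal (64 * δ ^ 3 / θ) := by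
    calc ENNReal.ofReal ((2 ^ 3 : ℝ)⁻¹ * L ^ 2 * N) * volume S
        = ∫⁻ _ in S, ENNReal.ofReal ((2 ^ 3 : ℝ)⁻¹ * L ^ 2 * N) := by
          rw [setLIntegral_const]
      _ ≤ ∫⁻ x in S, ∑ k, (tube 3 δ (η k) (b k)).indicator (fun _ => (1 : ℝ≥0∞)) x := by
          refine setLIntegral_mono' hS fun x hx => ?_
          classical
          have h1 : ∑ k, (tube 3 δ (η k) (b k)).indicator (fun _ => (1 : ℝ≥0∞)) x
              = (({k : Fin M₀ | x ∈ tube 3 δ (η k) (b k)}.ncard : ℕ) : ℝ≥0∞) := by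
            simp only [Set.indicator_apply]
            rw [Finset.sum_boole, Set.ncard_eq_toFinset_card']
            simp
          rw [h1, ← ENNReal.ofReal_natCast]
          exact ENNReal.ofReal_le_ofReal (hcount x hx)
      _ = ∑ k, volume (tube 3 δ (η k) (b k) ∩ S) := by
          rw [lintegral_finsetSum _ fun k _ =>
            measurable_const.indicator (measurableSet_tube _ _ _)]
          refine Finset.sum_congr rfl fun k _ => ?_
          rw [lintegral_indicator (measurableSet_tube _ _ _), setLIntegral_const, one_mul,
            Measure.restrict_apply (measurableSet_tube _ _ _)]
      _ ≤ ∑ _k : Fin M₀, ENNReal.ofReal (64 * δ ^ 3 / θ) :=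
          Finset.sum_le_sum fun k _ => hinter k
      _ = M₀ * ENNReal.ofReal (64 * δ ^ 3 / θ) := by simp
  have hS2 : ENNReal.ofReal ((2 ^ 3)⁻¹ * (4 * Real.logb 2 (1 / δ))⁻¹ ^ 2 * lam)
      * ENNReal.ofReal (δ ^ 2) ≤ volume S :=
    (mul_le_mul_right (volume_tube_ge hδ ξj aj hξ) _).trans hvol
  have h3 := (mul_le_mul_right hS2 (ENNReal.ofReal ((2 ^ 3 : ℝ)⁻¹ * L ^ 2 * N))).trans hmain
  rw [← ENNReal.ofReal_natCast, ← ENNReal.ofReal_mul (by positivity),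
    ← ENNReal.ofReal_mul (by positivity), ← ENNReal.ofReal_mul (by positivity),
    ENNReal.ofReal_le_ofReal_iff (by positivity), mul_inv, ← hL] at h3
  have h4 : (1 / 2 ^ 16 * θ * δ⁻¹ * N * lam * L ^ 4) * (64 * δ ^ 3 / θ)
      ≤ M₀ * (64 * δ ^ 3 / θ) := by
    refine le_trans (le_of_eq ?_) h3
    field_simp
    ring
  exact le_of_mul_le_mul_right h4 (by positivity)
end
end
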